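/- arXiv:1103.3939 — 3 statements merged into one kernel-verified Lean document; each statement's English description precedes it below -/
import Mathlib

section
/- Let q = p^f ≥ 7 be a prime power and let G be a finite almost simple group with socle S isomorphic to PSL_2(q). If p ≠ 3, then G has an irreducible complex representation of degree q + δ, where δ ∈ {1, −1} satisfies q ≡ δ (mod 3). If p = 3, then G has an irreducible complex representation of degree (q + ε)/2 or of degree q + ε, where ε ∈ {1, −1} satisfies q ≡ ε (mod 4). -/
open CategoryTheory

/-- The set of degrees of irreducible complex representations of `G`. -/
noncomputable def cd (G : Type) [Group G] : Set ℕ :=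
  {d | ∃ V : FDRep ℂ G, Simple V ∧ Module.finrank ℂ V = d}

theorem finrank_mem_cd {G : Type} [Group G] [Fintype G] {V : Type} [AddCommGroup V] [Module ℂ V]
    [FiniteDimensional ℂ V] (ρ : Representation ℂ G V) [ρ.IsIrreducible] :
    Module.finrank ℂ V ∈ cd G := by
  refine ⟨FDRep.of ρ, ?_, rfl⟩
  rw [FDRep.simple_iff_char_is_norm_one]
  have hG : (Nat.card G : ℂ) ≠ 0 := by simp [Nat.card_eq_fintype_card]
  have := invertibleOfNonzero hG
  have h := Representation.char_orthonormal ρ ρ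
  rw [if_pos ⟨Representation.Equiv.refl ρ⟩, inv_mul_eq_one₀ hG] at h
  exact h.symm

/-- If all nonzero invariant subspaces have at least half the dimension, then the representation is
irreducible or the sum of two irreducible representations of equal degree. -/
theorem exists_mem_cd_of_half_le {G : Type} [Group G] [Fintype G] {V : Type} [AddCommGroup V]
    [Module ℂ V] [FiniteDimensional ℂ V] [Nontrivial V] (ρ : Representation ℂ G V)
    (h : ∀ W : Submodule ℂ V, W ≠ ⊥ → (∀ g, ∀ v ∈ W, ρ g v ∈ W) →
      Module.finrank ℂ V ≤ 2 * Module.finrank ℂ W) :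
    ∃ W : Submodule ℂ V, W ≠ ⊥ ∧ (∀ g, ∀ v ∈ W, ρ g v ∈ W) ∧ Module.finrank ℂ W ∈ cd G ∧
      (Module.finrank ℂ W = Module.finrank ℂ V ∨
        2 * Module.finrank ℂ W = Module.finrank ℂ V) := by
  classical
  have hG : (Nat.card G : ℂ) ≠ 0 := by simp [Nat.card_eq_fintype_card]
  have : NeZero (Nat.card G : ℂ) := ⟨hG⟩
  have hex : ∃ n, ∃ W : Subrepresentation ρ, W.toSubmodule ≠ ⊥ ∧
      Module.finrank ℂ W.toSubmodule = n := ⟨_, ⊤, top_ne_bot, rfl⟩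
  obtain ⟨W, hW0, hWn⟩ := Nat.find_spec hex
  have hmin := fun m => Nat.find_min hex (m := m)
  rw [← hWn] at hmin
  have hirr : W.toRepresentation.IsIrreducible := by
    have : Nontrivial W.toSubmodule := Submodule.nontrivial_iff_ne_bot.2 hW0
    refine { exists_pair_ne := ⟨⊥, ⊤, fun hbt => ?_⟩, eq_bot_or_eq_top := fun X => ?_ }
    · have : (⊥ : Submodule ℂ W.toSubmodule) = ⊤ :=
        congrArg Subrepresentation.toSubmodule hbt
      exact bot_ne_top this
    · by_cases hX : X.toSubmodule = ⊥
      · exact Or.inl (Subrepresentation.toSubmodule_injective hX)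
      · right
        apply Subrepresentation.toSubmodule_injective
        have hX' : ∀ g, ∀ v ∈ X.toSubmodule.map W.toSubmodule.subtype,
            ρ g v ∈ X.toSubmodule.map W.toSubmodule.subtype := by
          rintro g _ ⟨v, hv, rfl⟩
          exact ⟨_, X.apply_mem_toSubmodule g hv, rfl⟩
        have hfr : Module.finrank ℂ (X.toSubmodule.map W.toSubmodule.subtype) =
            Module.finrank ℂ X.toSubmodule :=
          Submodule.finrank_map_subtype_eq _ _
        have hge : Module.finrank ℂ W.toSubmodule ≤ Module.finrank ℂ X.toSubmodule := by
          by_contra hlt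
          refine hmin _ (not_le.1 hlt)
            ⟨⟨X.toSubmodule.map W.toSubmodule.subtype, fun g v hv => hX' g v hv⟩, ?_, hfr⟩
          intro h0
          exact hX (Submodule.map_injective_of_injective
            W.toSubmodule.subtype_injective (h0.trans (Submodule.map_bot _).symm))
        exact Submodule.eq_top_of_finrank_eq (le_antisymm (Submodule.finrank_le _) hge)
  refine ⟨W.toSubmodule, hW0, fun g v hv => W.apply_mem_toSubmodule g hv,
    finrank_mem_cd W.toRepresentation, ?_⟩
  obtain ⟨W', hW'⟩ := exists_isCompl W
  have hc : IsCompl W.toSubmodule W'.toSubmodule := by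
    constructor
    · rw [disjoint_iff]
      exact congrArg Subrepresentation.toSubmodule hW'.inf_eq_bot
    · rw [codisjoint_iff]
      exact congrArg Subrepresentation.toSubmodule hW'.sup_eq_top
  have hsum := Submodule.finrank_add_eq_of_isCompl hc
  by_cases h0 : W'.toSubmodule = ⊥
  · left
    rw [h0, finrank_bot] at hsum
    omega
  · right
    have h1 := h _ hW0 fun g v hv => W.apply_mem_toSubmodule g hv
    have h2 := h _ h0 fun g v hv => W'.apply_mem_toSubmodule g hv
    omega

section SpecialLinear

open Matrix

variable {F : Type} [Field F]

/-- Upper unitriangular matrices. -/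
def upper (b : F) : SpecialLinearGroup (Fin 2) F := ⟨!![1, b; 0, 1], by simp [det_fin_two]⟩

/-- Lower unitriangular matrices. -/
def lower (b : F) : SpecialLinearGroup (Fin 2) F := ⟨!![1, 0; b, 1], by simp [det_fin_two]⟩

/-- The matrices representing the nontrivial Weyl element. -/
def weyl (a : F) : SpecialLinearGroup (Fin 2) F := upper a * lower (-a⁻¹) * upper a

/-- Diagonal matrices. -/
def diagonal (a : F) : SpecialLinearGroup (Fin 2) F := weyl a * weyl (-1)

theorem coe_upper (b : F) : (upper b).1 = !![1, b; 0, 1] := rfl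

theorem coe_lower (b : F) : (lower b).1 = !![1, 0; b, 1] := rfl

theorem coe_weyl {a : F} (ha : a ≠ 0) : (weyl a).1 = !![0, a; -a⁻¹, 0] := by
  change (upper a).1 * (lower (-a⁻¹)).1 * (upper a).1 = _
  rw [coe_upper, coe_lower]
  simp [ha]

theorem coe_diagonal {a : F} (ha : a ≠ 0) : (diagonal a).1 = !![a, 0; 0, a⁻¹] := by
  change (weyl a).1 * (weyl (-1)).1 = _
  rw [coe_weyl ha, coe_weyl (neg_ne_zero.2 one_ne_zero)]
  simp

theorem upper_add (a b : F) : upper (a + b) = upper a * upper b := by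
  apply Subtype.ext
  change _ = (upper a).1 * (upper b).1
  simp [coe_upper, add_comm]

theorem lower_add (a b : F) : lower (a + b) = lower a * lower b := by
  apply Subtype.ext
  change _ = (lower a).1 * (lower b).1
  simp [coe_lower]

theorem upper_zero : upper (0 : F) = 1 := by
  apply Subtype.ext
  simp [coe_upper, one_fin_two]

theorem lower_zero : lower (0 : F) = 1 := by
  apply Subtype.ext
  simp [coe_lower, one_fin_two]

theorem upper_neg (a : F) : upper (-a) = (upper a)⁻¹ :=
  eq_inv_of_mul_eq_one_left (by rw [← upper_add, neg_add_cancel, upper_zero])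

theorem lower_neg (a : F) : lower (-a) = (lower a)⁻¹ :=
  eq_inv_of_mul_eq_one_left (by rw [← lower_add, neg_add_cancel, lower_zero])

theorem weyl_neg (a : F) : weyl (-a) = (weyl a)⁻¹ := by
  rw [weyl, weyl, _root_.mul_inv_rev, _root_.mul_inv_rev, ← upper_neg, ← lower_neg, inv_neg,
    mul_assoc]

theorem weyl_conj_upper {a : F} (ha : a ≠ 0) (b : F) :
    weyl a * upper b * (weyl a)⁻¹ = lower (-(b / a ^ 2)) := by
  rw [← weyl_neg]
  apply Subtype.ext
  change (weyl a).1 * (upper b).1 * (weyl (-a)).1 = _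
  rw [coe_weyl ha, coe_weyl (neg_ne_zero.2 ha), coe_upper, coe_lower]
  simp [ha]
  field_simp

/-- `SL₂` over a field is generated by unitriangular matrices. -/
theorem eq_top_of_upper_of_lower {H : Subgroup (SpecialLinearGroup (Fin 2) F)}
    (hu : ∀ b, upper b ∈ H) (hl : ∀ b, lower b ∈ H) : H = ⊤ := by
  rw [Subgroup.eq_top_iff']
  refine SL2.transvection_induction (· ∈ H) (fun i j h c => ?_) fun _ _ => mul_mem
  have key : SpecialLinearGroup.transvection h c = if i = 0 then upper c else lower c := by
    fin_cases i <;> fin_cases j <;> first | exact absurd rfl h | skip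
    all_goals
      apply Subtype.ext
      ext k l
      fin_cases k <;> fin_cases l <;>
        simp [SpecialLinearGroup.transvection_coe, upper, lower]
  rw [key]
  split_ifs
  exacts [hu c, hl c]

end SpecialLinear

/-- A quadratic étale algebra `E` over a finite field `F` (a quadratic field extension or `F × F`)
given by its conjugation, norm and trace; `sign` is `1` in the split case and `-1` otherwise. -/
structure QuadraticEtale (F E : Type) [Field F] [Fintype F] [CommRing E] [Fintype E]
    [Algebra F E] where
  conj : E ≃ₐ[F] E
  norm : E →* F
  tr : E →ₗ[F] F
  sign : ℤ
  conj_conj : ∀ x, conj (conj x) = x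
  mul_conj : ∀ x, x * conj x = algebraMap F E (norm x)
  add_conj : ∀ x, x + conj x = algebraMap F E (tr x)
  sign_sq : sign ^ 2 = 1
  card_eq : Nat.card E = Nat.card F ^ 2
  card_norm_one : (Nat.card {x : E // norm x = 1} : ℤ) = Nat.card F - sign
  norm_surjective : Function.Surjective norm
  nondegenerate : ∀ x, (∀ y, tr (x * conj y) = 0) → x = 0
  eq_or_eq_conj : ∀ y z, norm y = norm z → tr y = tr z → y = z ∨ y = conj z
  norm_one_free : ∀ k x, norm k = 1 → k * x = x → x = 0 ∨ k = 1
  norm_zero_smul : ∀ x, norm x = 0 → x ≠ 0 → ∀ k, norm k = 1 → ∃ a : F, k * x = a • x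
  exists_isotropic : sign = 1 → ∃ x, x ≠ 0 ∧ norm x = 0 ∧ ∀ y z, norm y ≠ 0 → norm y = norm z →
    tr (x * conj y) = tr (x * conj z) → y = z

namespace QuadraticEtale

open Finset

variable {F E : Type} [Field F] [Fintype F] [CommRing E] [Fintype E] [Algebra F E]
  (D : QuadraticEtale F E)

theorem nontrivial (D : QuadraticEtale F E) : Nontrivial E := by
  by_contra h
  rw [not_nontrivial_iff_subsingleton] at h
  have h1 := D.card_eq
  have h2 : 1 < Nat.card F := Finite.one_lt_card
  rw [Nat.card_of_subsingleton (0 : E)] at h1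
  nlinarith

theorem algebraMap_injective (D : QuadraticEtale F E) : Function.Injective (algebraMap F E) :=
  have := D.nontrivial
  FaithfulSMul.algebraMap_injective F E

/-- The polar form of the norm. -/
def polar (x y : E) : F := D.tr (x * D.conj y)

theorem tr_conj (x : E) : D.tr (D.conj x) = D.tr x := by
  apply D.algebraMap_injective
  rw [← D.add_conj, ← D.add_conj, D.conj_conj, add_comm]

theorem norm_conj (x : E) : D.norm (D.conj x) = D.norm x := by
  apply D.algebraMap_injective
  rw [← D.mul_conj, ← D.mul_conj, D.conj_conj, mul_comm]

theorem polar_comm (x y : E) : D.polar x y = D.polar y x := by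
  rw [polar, ← D.tr_conj, map_mul, D.conj_conj, mul_comm, polar]

theorem polar_add_right (x y z : E) : D.polar x (y + z) = D.polar x y + D.polar x z := by
  simp [polar, mul_add]

theorem polar_add_left (x y z : E) : D.polar (x + y) z = D.polar x z + D.polar y z := by
  simp [polar, add_mul]

theorem polar_smul_left (a : F) (x y : E) : D.polar (a • x) y = a * D.polar x y := by
  simp [polar]

theorem polar_smul_right (a : F) (x y : E) : D.polar x (a • y) = a * D.polar x y := by
  simp [polar]

theorem norm_algebraMap (a : F) : D.norm (algebraMap F E a) = a ^ 2 := by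
  apply D.algebraMap_injective
  rw [← D.mul_conj, D.conj.commutes, map_pow, sq]

theorem norm_smul (a : F) (x : E) : D.norm (a • x) = a ^ 2 * D.norm x := by
  rw [Algebra.smul_def, map_mul, norm_algebraMap]

theorem norm_add (x y : E) : D.norm (x + y) = D.norm x + D.polar x y + D.norm y := by
  apply D.algebraMap_injective
  rw [← D.mul_conj, map_add, map_add, map_add, ← D.mul_conj, ← D.mul_conj, polar, ← D.add_conj,
    map_mul, D.conj_conj]
  ring

theorem norm_sub (x y : E) : D.norm (x - y) = D.norm x - D.polar x y + D.norm y := by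
  rw [sub_eq_add_neg, norm_add, ← neg_one_smul F y, polar_smul_right, norm_smul]
  ring

theorem polar_mul_mul (k x y : E) : D.polar (k * x) (k * y) = D.norm k * D.polar x y := by
  rw [polar, map_mul D.conj,
    show k * x * (D.conj k * D.conj y) = k * D.conj k * (x * D.conj y) by ring,
    D.mul_conj, ← Algebra.smul_def, map_smul, smul_eq_mul, polar]

theorem isUnit_of_norm_ne_zero {x : E} (hx : D.norm x ≠ 0) : IsUnit x := by
  refine IsUnit.of_mul_eq_one (algebraMap F E (D.norm x)⁻¹ * D.conj x) ?_
  rw [mul_left_comm, D.mul_conj, ← map_mul, inv_mul_cancel₀ hx, map_one]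

theorem card_norm_eq [DecidableEq F] {n : F} (hn : n ≠ 0) :
    (#{x : E | D.norm x = n} : ℤ) = Nat.card F - D.sign := by
  rw [← D.card_norm_one]
  congr 1
  obtain ⟨x, rfl⟩ := D.norm_surjective n
  obtain ⟨x, rfl⟩ := D.isUnit_of_norm_ne_zero hn
  rw [Nat.card_eq_fintype_card, Fintype.card_subtype]
  refine card_bij' (fun y _ => ↑x⁻¹ * y) (fun y _ => x * y) ?_ ?_ ?_ ?_
  · intro y hy
    simp only [mem_filter, mem_univ, true_and] at hy ⊢
    rw [map_mul, hy, ← map_mul, Units.inv_mul, map_one]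
  · intro y hy
    simp only [mem_filter, mem_univ, true_and] at hy ⊢
    rw [map_mul, hy, mul_one]
  · simp
  · simp

variable {ψ : AddChar F ℂ}

theorem sum_addChar_mul_eq_zero (hψ : ψ ≠ 1) {m : F} (hm : m ≠ 0) : ∑ b, ψ (m * b) = 0 := by
  rw [← AddChar.sum_eq_zero_of_ne_one hψ]
  exact Equiv.sum_comp (Equiv.mulLeft₀ m hm) fun b => ψ b

theorem sum_addChar_mul [DecidableEq F] (hψ : ψ ≠ 1) (m : F) :
    ∑ b, ψ (m * b) = if m = 0 then (Nat.card F : ℂ) else 0 := by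
  split_ifs with h
  · simp [h]
  · exact sum_addChar_mul_eq_zero hψ h

theorem sum_addChar_norm (hψ : ψ ≠ 1) {m : F} (hm : m ≠ 0) :
    ∑ y, ψ (m * D.norm y) = D.sign * Nat.card F := by
  classical
  have hfib : ∀ f : F → ℂ, ∑ y, f (D.norm y) = ∑ n, (#{x : E | D.norm x = n} : ℂ) * f n := by
    intro f
    rw [← sum_fiberwise_of_maps_to (t := univ) (g := D.norm) (by simp)]
    refine sum_congr rfl fun n _ => ?_
    rw [sum_congr rfl (g := fun _ => f n) fun y hy => by rw [(mem_filter.1 hy).2]]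
    simp
  have hN : ∀ n : F, n ≠ 0 → (#{x : E | D.norm x = n} : ℂ) = Nat.card F - D.sign := by
    intro n hn
    exact_mod_cast congrArg (Int.cast : ℤ → ℂ) (D.card_norm_eq hn)
  have hsplit : ∀ f : F → ℂ, ∑ y, f (D.norm y) =
      #{x : E | D.norm x = 0} * f 0 + (Nat.card F - D.sign) * (∑ n, f n - f 0) := by
    intro f
    rw [hfib f, ← add_sum_erase _ _ (mem_univ (0 : F)), ← add_sum_erase _ f (mem_univ (0 : F)),
      add_sub_cancel_left, mul_sum]
    congr 1
    exact sum_congr rfl fun n hn => by rw [hN n (ne_of_mem_erase hn)]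
  have h0 := hsplit fun _ => 1
  rw [hsplit fun n => ψ (m * n), sum_addChar_mul_eq_zero hψ hm]
  have hE : (Nat.card E : ℂ) = Nat.card F ^ 2 := by
    exact_mod_cast congrArg (Nat.cast : ℕ → ℂ) D.card_eq
  simp only [sum_const, card_univ, nsmul_eq_mul, mul_one, ← Nat.card_eq_fintype_card] at h0
  simp only [mul_zero, AddChar.map_zero_eq_one]
  linear_combination hE - h0

theorem sum_addChar_polar (hψ : ψ ≠ 1) {h : E} (hh : h ≠ 0) : ∑ y, ψ (D.polar h y) = 0 := by
  let χ : AddChar E ℂ :=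
    { toFun := fun y => ψ (D.polar h y)
      map_zero_eq_one' := by simp [polar]
      map_add_eq_mul' := fun x y => by rw [polar_add_right, AddChar.map_add_eq_mul] }
  refine AddChar.sum_eq_zero_of_ne_one (ψ := χ) fun hχ => hh (D.nondegenerate h fun y => ?_)
  by_contra hy
  change D.polar h y ≠ 0 at hy
  obtain ⟨z, hz⟩ := AddChar.ne_one_iff.1 hψ
  apply hz
  have : χ ((z / D.polar h y) • y) = 1 := by rw [hχ]; rfl
  change ψ (D.polar h _) = 1 at this
  rwa [polar_smul_right, div_mul_cancel₀ _ hy] at this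

/-- The sum of a quadratic phase with a linear term, by completing the square. -/
theorem sum_addChar_norm_sub_polar (hψ : ψ ≠ 1) {m : F} (hm : m ≠ 0) (h : E) :
    ∑ y, ψ (m * D.norm y - D.polar h y) = D.sign * Nat.card F * ψ (-(D.norm h / m)) := by
  rw [← D.sum_addChar_norm hψ hm, sum_mul,
    ← Equiv.sum_comp (Equiv.subRight (m⁻¹ • h)) fun y => ψ (m * D.norm y) * ψ (-(D.norm h / m))]
  refine sum_congr rfl fun y _ => ?_
  rw [← AddChar.map_add_eq_mul]
  congr 1
  rw [Equiv.subRight_apply, norm_sub, norm_smul, polar_smul_right, polar_comm D h y]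
  field_simp
  ring

variable (ψ)

/-- The operator of the Weil representation attached to a matrix. -/
noncomputable def weilOp [DecidableEq F] (g : Matrix.SpecialLinearGroup (Fin 2) F) :
    (E → ℂ) →ₗ[ℂ] (E → ℂ) :=
  if g 1 0 = 0 then
    { toFun := fun f x => ψ (g 0 0 * g 0 1 * D.norm x) * f (g 0 0 • x)
      map_add' := fun f f' => by ext x; simp [mul_add]
      map_smul' := fun r f => by ext x; simp [mul_left_comm] }
  else
    { toFun := fun f x => D.sign / Nat.card F *
        ∑ y, ψ ((g 0 0 * D.norm x - D.polar x y + g 1 1 * D.norm y) / g 1 0) * f y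
      map_add' := fun f f' => by ext x; simp [mul_add, sum_add_distrib]
      map_smul' := fun r f => by
        ext x
        simp only [Pi.smul_apply, smul_eq_mul, RingHom.id_apply, mul_sum]
        exact sum_congr rfl fun y _ => by ring }

variable [DecidableEq F]

theorem weilOp_of_eq_zero {g : Matrix.SpecialLinearGroup (Fin 2) F} (hg : g 1 0 = 0) (f : E → ℂ)
    (x : E) : D.weilOp ψ g f x = ψ (g 0 0 * g 0 1 * D.norm x) * f (g 0 0 • x) := by
  rw [weilOp, if_pos hg]
  rfl

theorem weilOp_of_ne_zero {g : Matrix.SpecialLinearGroup (Fin 2) F} (hg : g 1 0 ≠ 0) (f : E → ℂ)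
    (x : E) : D.weilOp ψ g f x = D.sign / Nat.card F *
      ∑ y, ψ ((g 0 0 * D.norm x - D.polar x y + g 1 1 * D.norm y) / g 1 0) * f y := by
  rw [weilOp, if_neg hg]
  rfl

variable {ψ}

open Matrix in
theorem weilOp_mul (hψ : ψ ≠ 1) (g g' : Matrix.SpecialLinearGroup (Fin 2) F) :
    D.weilOp ψ (g * g') = D.weilOp ψ g * D.weilOp ψ g' := by
  classical
  have hdet := g.det_coe
  have hdet' := g'.det_coe
  rw [det_fin_two] at hdet hdet'
  have e00 : (g * g') 0 0 = g 0 0 * g' 0 0 + g 0 1 * g' 1 0 := by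
    simp [mul_apply, Fin.sum_univ_two]
  have e01 : (g * g') 0 1 = g 0 0 * g' 0 1 + g 0 1 * g' 1 1 := by
    simp [mul_apply, Fin.sum_univ_two]
  have e10 : (g * g') 1 0 = g 1 0 * g' 0 0 + g 1 1 * g' 1 0 := by
    simp [mul_apply, Fin.sum_univ_two]
  have e11 : (g * g') 1 1 = g 1 0 * g' 0 1 + g 1 1 * g' 1 1 := by
    simp [mul_apply, Fin.sum_univ_two]
  have hq : (Nat.card F : ℂ) ≠ 0 := by simp [Nat.card_eq_fintype_card]
  have hs : (D.sign : ℂ) ^ 2 = 1 := by exact_mod_cast congrArg (Int.cast : ℤ → ℂ) D.sign_sq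
  generalize hA : g 0 0 = a at *
  generalize hB : g 0 1 = b at *
  generalize hC : g 1 0 = c at *
  generalize hD : g 1 1 = d at *
  generalize hA' : g' 0 0 = a' at *
  generalize hB' : g' 0 1 = b' at *
  generalize hC' : g' 1 0 = c' at *
  generalize hD' : g' 1 1 = d' at *
  refine LinearMap.ext fun f => funext fun x => ?_
  rw [Module.End.mul_apply]
  by_cases hc : c = 0
  · subst hc
    have had : a * d = 1 := by linear_combination hdet
    have ha : a ≠ 0 := left_ne_zero_of_mul_eq_one had
    have hd : d = a⁻¹ := eq_inv_of_mul_eq_one_right had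
    subst hd
    rw [weilOp_of_eq_zero D ψ (g := g) hC, hA, hB]
    by_cases hc' : c' = 0
    · subst hc'
      rw [weilOp_of_eq_zero D ψ (g := g') hC',
        weilOp_of_eq_zero D ψ (g := g * g') (by rw [e10]; simp), hA', hB', e00, e01,
          ← mul_assoc, ← AddChar.map_add_eq_mul, norm_smul, smul_smul]
      have had' : a' * d' = 1 := by linear_combination hdet'
      congr 2
      · linear_combination (a * b * D.norm x) * had'
      · congr 1
        ring
    · rw [weilOp_of_ne_zero D ψ (g := g') (by rwa [hC']),
        weilOp_of_ne_zero D ψ (g := g * g') (by rw [e10]; simp [ha, hc']), hA', hC', hD', e00, e10,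
        e11, mul_left_comm (ψ _)]
      congr 1
      rw [mul_sum]
      refine sum_congr rfl fun y _ => ?_
      rw [← mul_assoc, ← AddChar.map_add_eq_mul, norm_smul, polar_smul_left]
      congr 2
      rw [zero_mul, zero_add, zero_mul, zero_add]
      field_simp
      ring
  · rw [weilOp_of_ne_zero D ψ (g := g) (by rwa [hC]), hA, hC, hD]
    by_cases hc' : c' = 0
    · subst hc'
      have had' : a' * d' = 1 := by linear_combination hdet'
      have ha' : a' ≠ 0 := left_ne_zero_of_mul_eq_one had'
      have hd' : d' = a'⁻¹ := eq_inv_of_mul_eq_one_right had'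
      subst hd'
      rw [weilOp_of_ne_zero D ψ (g := g * g') (by rw [e10]; simp [hc, ha']), e00, e10, e11]
      congr 1
      rw [← Equiv.sum_comp (MulAction.toPerm (Units.mk0 a' ha') : Equiv.Perm E)]
      refine sum_congr rfl fun y _ => ?_
      rw [weilOp_of_eq_zero D ψ (g := g') hC', hA', hB', MulAction.toPerm_apply, Units.smul_def,
        Units.val_mk0, ← mul_assoc, ← AddChar.map_add_eq_mul, norm_smul, polar_smul_right]
      congr 2
      field_simp
      ring
    · simp_rw [weilOp_of_ne_zero D ψ (g := g') (by rwa [hC']), hA', hC', hD', mul_sum]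
      rw [sum_comm]
      by_cases hc'' : c * a' + d * c' = 0
      · have key : ∀ z, ∑ y, D.sign / (Nat.card F : ℂ) *
            (ψ ((a * D.norm x - D.polar x y + d * D.norm y) / c) * (D.sign / (Nat.card F : ℂ) *
              (ψ ((a' * D.norm y - D.polar y z + d' * D.norm z) / c') * f z))) =
            if z = (-(c' / c)) • x then ψ (a * D.norm x / c + d' * D.norm z / c') * f z else 0 := by
          intro z
          have h1 : ∀ y, D.sign / (Nat.card F : ℂ) *
            (ψ ((a * D.norm x - D.polar x y + d * D.norm y) / c) * (D.sign / (Nat.card F : ℂ) *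
              (ψ ((a' * D.norm y - D.polar y z + d' * D.norm z) / c') * f z))) =
              (D.sign : ℂ) ^ 2 / (Nat.card F : ℂ) ^ 2 * (ψ (a * D.norm x / c + d' * D.norm z / c') *
                f z) * ψ (D.polar (-(c⁻¹ • x + c'⁻¹ • z)) y) := by
            intro y
            have : ψ ((a * D.norm x - D.polar x y + d * D.norm y) / c) *
                ψ ((a' * D.norm y - D.polar y z + d' * D.norm z) / c') =
                ψ (a * D.norm x / c + d' * D.norm z / c') *
                  ψ (D.polar (-(c⁻¹ • x + c'⁻¹ • z)) y) := by
              rw [← AddChar.map_add_eq_mul, ← AddChar.map_add_eq_mul]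
              congr 1
              rw [← neg_one_smul F (_ + _), polar_smul_left, polar_add_left, polar_smul_left,
                polar_smul_left, polar_comm D y z]
              field_simp
              linear_combination D.norm y * hc''
            linear_combination ((D.sign : ℂ) ^ 2 / (Nat.card F : ℂ) ^ 2 * f z) * this
          rw [sum_congr rfl fun y _ => h1 y, ← mul_sum]
          split_ifs with hz
          · have h0 : -(c⁻¹ • x + c'⁻¹ • z) = 0 := by
              rw [hz, smul_smul, ← add_smul]
              have : c⁻¹ + c'⁻¹ * -(c' / c) = 0 := by field_simp; ring
              rw [this, zero_smul, neg_zero]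
            rw [h0]
            have hE : (Nat.card E : ℂ) = Nat.card F ^ 2 := by
              exact_mod_cast congrArg (Nat.cast : ℕ → ℂ) D.card_eq
            rw [Nat.card_eq_fintype_card] at hE
            simp [polar, hE, hs]
            field_simp
          · rw [D.sum_addChar_polar hψ, mul_zero]
            intro h0
            apply hz
            rw [neg_eq_zero, add_comm] at h0
            have := congrArg (fun w => c' • w) (eq_neg_of_add_eq_zero_left h0)
            simp only [smul_smul, mul_inv_cancel₀ hc', one_smul, smul_neg] at this
            rw [this, neg_smul, div_eq_mul_inv]
        rw [sum_congr rfl fun z _ => key z, sum_ite_eq', if_pos (mem_univ _),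
          weilOp_of_eq_zero D ψ (g := g * g') (by rw [e10, hc'']), e00, e01, norm_smul]
        have ha'' : a * a' + b * c' = -(c' / c) := by
          field_simp
          linear_combination a * hc'' - c' * hdet
        rw [ha'']
        congr 2
        have hb : c * c' * (a * b' + b * d') = - (c * a + c' * d') + 
            (c * a' + d * c') * (a * d') := by
          linear_combination (-c * a) * hdet' - (c' * d') * hdet
        rw [hc''] at hb
        field_simp
        linear_combination (-D.norm x) * hb
      · rw [weilOp_of_ne_zero D ψ (g := g * g') (by rwa [e10]), e00, e10, e11, mul_sum]
        refine sum_congr rfl fun z _ => ?_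
        have hm : (c * a' + d * c') / (c * c') ≠ 0 := by positivity
        have key := D.sum_addChar_norm_sub_polar hψ hm (c⁻¹ • x + c'⁻¹ • z)
        have h1 : ∀ y, D.sign / (Nat.card F : ℂ) *
            (ψ ((a * D.norm x - D.polar x y + d * D.norm y) / c) * (D.sign / (Nat.card F : ℂ) *
              (ψ ((a' * D.norm y - D.polar y z + d' * D.norm z) / c') * f z))) =
              (D.sign : ℂ) ^ 2 / (Nat.card F : ℂ) ^ 2 * (ψ (a * D.norm x / c + d' * D.norm z / c') *
                f z) * ψ ((c * a' + d * c') / (c * c') * D.norm y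
                  - D.polar (c⁻¹ • x + c'⁻¹ • z) y) := by
          intro y
          have : ψ ((a * D.norm x - D.polar x y + d * D.norm y) / c) *
              ψ ((a' * D.norm y - D.polar y z + d' * D.norm z) / c') =
              ψ (a * D.norm x / c + d' * D.norm z / c') *
                ψ ((c * a' + d * c') / (c * c') * D.norm y
                  - D.polar (c⁻¹ • x + c'⁻¹ • z) y) := by
            rw [← AddChar.map_add_eq_mul, ← AddChar.map_add_eq_mul]
            congr 1
            rw [polar_add_left, polar_smul_left, polar_smul_left, polar_comm D y z]
            field_simp
            ring
          linear_combination ((D.sign : ℂ) ^ 2 / (Nat.card F : ℂ) ^ 2 * f z) * this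
        rw [sum_congr rfl fun y _ => h1 y, ← mul_sum, key]
        have h2 : ψ (a * D.norm x / c + d' * D.norm z / c') *
            ψ (-(D.norm (c⁻¹ • x + c'⁻¹ • z) / ((c * a' + d * c') / (c * c')))) =
            ψ (((a * a' + b * c') * D.norm x - D.polar x z + (c * b' + d * d') * D.norm z) /
              (c * a' + d * c')) := by
          rw [← AddChar.map_add_eq_mul]
          congr 1
          rw [norm_add, norm_smul, norm_smul, polar_smul_left, polar_smul_right]
          obtain ⟨e, he⟩ : ∃ e, e = c * a' + d * c' := ⟨_, rfl⟩
          rw [← he] at hc'' ⊢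
          field_simp
          linear_combination (D.norm x * c' ^ 2) * hdet + (D.norm z * c ^ 2) * hdet' +
            (D.norm x * c' * a + D.norm z * c * d') * he
        rw [← h2, hs]
        field_simp

end QuadraticEtale

namespace QuadraticEtale

open Finset

variable {F E : Type} [Field F] [Fintype F] [CommRing E] [Fintype E] [Algebra F E]
  (D : QuadraticEtale F E)

/-- A character of the multiplicative monoid that is trivial on `F` but not on norm one elements. -/
structure Character where
  toHom : E →* ℂ
  map_algebraMap : ∀ a : F, a ≠ 0 → toHom (algebraMap F E a) = 1
  exists_ne_one : ∃ k, D.norm k = 1 ∧ toHom k ≠ 1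

namespace Character

instance : CoeFun D.Character fun _ => E → ℂ := ⟨fun ω => ω.toHom⟩

variable {D} (ω : D.Character)

theorem map_one : ω 1 = 1 := _root_.map_one ω.toHom

theorem map_mul (x y : E) : ω (x * y) = ω x * ω y := _root_.map_mul ω.toHom x y

theorem map_smul {a : F} (ha : a ≠ 0) (x : E) : ω (a • x) = ω x := by
  rw [Algebra.smul_def, map_mul, ω.map_algebraMap a ha, one_mul]

theorem mul_map_conj {x : E} (hx : D.norm x ≠ 0) : ω x * ω (D.conj x) = 1 := by
  rw [← map_mul, D.mul_conj, ω.map_algebraMap _ hx]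

theorem ne_zero {x : E} (hx : D.norm x ≠ 0) : ω x ≠ 0 :=
  left_ne_zero_of_mul_eq_one (ω.mul_map_conj hx)

/-- The functions transforming by `ω` under multiplication by norm one elements. -/
def isotypic : Submodule ℂ (E → ℂ) where
  carrier := {f | ∀ k x, D.norm k = 1 → f (k * x) = ω k * f x}
  zero_mem' := fun k x _ => by simp
  add_mem' := fun hf hf' k x hk => by simp [hf k x hk, hf' k x hk, mul_add]
  smul_mem' := fun c f hf k x hk => by simp [hf k x hk, mul_left_comm]

theorem apply_zero_of_mem {f : E → ℂ} (hf : f ∈ ω.isotypic) : f 0 = 0 := by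
  obtain ⟨k, hk, hk1⟩ := ω.exists_ne_one
  have := hf k 0 hk
  rw [mul_zero] at this
  by_contra h0
  exact hk1 (mul_right_cancel₀ h0 (by rw [one_mul, ← this]))

theorem weilOp_mem [DecidableEq F] (ψ : AddChar F ℂ) (g : Matrix.SpecialLinearGroup (Fin 2) F)
    {f : E → ℂ} (hf : f ∈ ω.isotypic) : D.weilOp ψ g f ∈ ω.isotypic := by
  intro k x hk
  by_cases hg : g 1 0 = 0
  · rw [weilOp_of_eq_zero D ψ hg, weilOp_of_eq_zero D ψ hg, D.norm.map_mul, hk, one_mul,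
      ← mul_smul_comm, hf k _ hk, mul_left_comm]
  · rw [weilOp_of_ne_zero D ψ hg, weilOp_of_ne_zero D ψ hg, mul_left_comm]
    congr 1
    obtain ⟨u, rfl⟩ := D.isUnit_of_norm_ne_zero (x := k) (by simp [hk])
    rw [← Equiv.sum_comp (Units.mulLeft u), mul_sum]
    refine sum_congr rfl fun y _ => ?_
    rw [Units.mulLeft_apply, polar_mul_mul, hf _ _ hk, D.norm.map_mul, D.norm.map_mul, hk, one_mul,
      one_mul, one_mul, mul_left_comm]

/-- Norm one units. -/
def normOne (D : QuadraticEtale F E) : Subgroup Eˣ := (Units.map D.norm).ker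

theorem mem_normOne {k : Eˣ} : k ∈ normOne D ↔ D.norm k = 1 := by
  rw [normOne, MonoidHom.mem_ker, Units.ext_iff]
  rfl

/-- The action of norm one units on functions for which `ω.isotypic` is the space of invariants. -/
noncomputable def twist : Representation ℂ (normOne D) (E → ℂ) where
  toFun k :=
    { toFun := fun f x => ω (k⁻¹ : Eˣ) * f (((k : Eˣ) : E) * x)
      map_add' := fun f f' => by ext x; simp [mul_add]
      map_smul' := fun c f => by ext x; simp [mul_left_comm] }
  map_one' := by
    refine LinearMap.ext fun f => funext fun x => ?_
    simp [map_one]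
  map_mul' := fun k l => by
    refine LinearMap.ext fun f => funext fun x => ?_
    simp only [Module.End.mul_apply, LinearMap.coe_mk, AddHom.coe_mk, Subgroup.coe_mul,
      Units.val_mul, mul_inv_rev, map_mul]
    rw [mul_assoc, ← mul_assoc ((l : Eˣ) : E), mul_comm ((l : Eˣ) : E) ((k : Eˣ) : E), mul_left_comm]

theorem invariants_twist : ω.twist.invariants = ω.isotypic := by
  ext f
  rw [Representation.mem_invariants]
  have h1 : ∀ k : Eˣ, ω k * ω (k⁻¹ : Eˣ) = 1 := fun k => by
    rw [← map_mul, Units.mul_inv, map_one]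
  constructor
  · intro h k x hk
    obtain ⟨u, rfl⟩ := D.isUnit_of_norm_ne_zero (x := k) (by simp [hk])
    have : ω (u⁻¹ : Eˣ) * f (u * x) = f x := congrFun (h ⟨u, mem_normOne.2 hk⟩) x
    rw [← this, ← mul_assoc, h1, one_mul]
  · rintro h ⟨k, hk⟩
    funext x
    change ω (k⁻¹ : Eˣ) * f (k * x) = f x
    rw [h k x (mem_normOne.1 hk), ← mul_assoc, mul_comm (ω _), h1, one_mul]

theorem sum_normOne [Fintype (normOne D)] : ∑ k : normOne D, ω (k⁻¹ : Eˣ) = 0 := by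
  obtain ⟨k, hk, hk1⟩ := ω.exists_ne_one
  obtain ⟨u, rfl⟩ := D.isUnit_of_norm_ne_zero (x := k) (by simp [hk])
  have h := Equiv.sum_comp (Equiv.mulRight (⟨u, mem_normOne.2 hk⟩⁻¹ : normOne D))
    fun k => ω (k⁻¹ : Eˣ)
  simp only [Equiv.coe_mulRight, Subgroup.coe_mul, mul_inv_rev, Units.val_mul, map_mul,
    Subgroup.coe_inv, inv_inv, ← mul_sum] at h
  by_contra h0
  exact hk1 (mul_right_cancel₀ h0 (by rw [h, one_mul]))

theorem character_twist [DecidableEq E] (k : normOne D) :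
    ω.twist.character k = ω (k⁻¹ : Eˣ) * #{x : E | ((k : Eˣ) : E) * x = x} := by
  rw [Representation.character, LinearMap.trace_eq_matrix_trace ℂ (Pi.basisFun ℂ E), Matrix.trace]
  have : ∀ x, Matrix.diag (LinearMap.toMatrix (Pi.basisFun ℂ E) (Pi.basisFun ℂ E) (ω.twist k)) x =
      if ((k : Eˣ) : E) * x = x then ω (k⁻¹ : Eˣ) else 0 := by
    intro x
    rw [Matrix.diag_apply, LinearMap.toMatrix_apply, Pi.basisFun_repr, Pi.basisFun_apply]
    change ω (k⁻¹ : Eˣ) * Pi.single (M := fun _ => ℂ) x 1 (((k : Eˣ) : E) * x) = _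
    rw [Pi.single_apply, mul_ite, mul_one, mul_zero]
  rw [sum_congr rfl fun x _ => this x, ← sum_filter, sum_const, nsmul_eq_mul, mul_comm]

theorem finrank_isotypic : (Module.finrank ℂ ω.isotypic : ℤ) = Nat.card F + D.sign := by
  classical
  let _ : Fintype (normOne D) := Fintype.ofFinite _
  have hcard : (Nat.card (normOne D) : ℤ) = Nat.card F - D.sign := by
    rw [← D.card_norm_one]
    congr 1
    refine Nat.card_congr
      { toFun := fun k => ⟨(k : Eˣ), mem_normOne.1 k.2⟩
        invFun := fun k => ⟨(D.isUnit_of_norm_ne_zero (x := (k : E)) (by simp [k.2])).unit,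
          mem_normOne.2 k.2⟩
        left_inv := fun k => by ext; rfl
        right_inv := fun k => by ext; rfl }
  have hcard' : (Nat.card (normOne D) : ℂ) = Nat.card F - D.sign := by exact_mod_cast hcard
  have hpos : (Nat.card (normOne D) : ℂ) ≠ 0 := by simp [Nat.card_eq_fintype_card]
  have := invertibleOfNonzero hpos
  have h := Representation.card_inv_mul_sum_char_eq_finrank ω.twist
  rw [inv_mul_eq_iff_eq_mul₀ hpos, invariants_twist] at h
  have hch : ∀ k : normOne D, ω.twist.character k = ω (k⁻¹ : Eˣ) +
      if k = 1 then (Nat.card E : ℂ) - 1 else 0 := by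
    intro k
    rw [character_twist]
    split_ifs with hk
    · subst hk
      simp [map_one, Nat.card_eq_fintype_card]
    · have : ({x : E | ((k : Eˣ) : E) * x = x} : Finset E) = {0} := by
        ext x
        simp only [mem_filter, mem_univ, true_and, mem_singleton]
        constructor
        · intro hx
          refine (D.norm_one_free _ x (mem_normOne.1 k.2) hx).resolve_right fun hk' => hk ?_
          ext
          exact hk'
        · rintro rfl
          simp
      rw [this]
      simp
  rw [sum_congr rfl fun k _ => hch k, sum_add_distrib, sum_normOne, zero_add, sum_ite_eq',
    if_pos (mem_univ _), hcard', show (Nat.card E : ℂ) = Nat.card F ^ 2 by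
      exact_mod_cast congrArg (Nat.cast : ℕ → ℂ) D.card_eq] at h
  have hs : (D.sign : ℂ) ^ 2 = 1 := by exact_mod_cast congrArg (Int.cast : ℤ → ℂ) D.sign_sq
  have : (Module.finrank ℂ ω.isotypic : ℂ) = Nat.card F + D.sign := by
    rw [hcard'] at hpos
    refine mul_left_cancel₀ hpos ?_
    rw [← h]
    linear_combination hs
  exact_mod_cast this

end Character

end QuadraticEtale

namespace QuadraticEtale

open Finset

variable {F E : Type} [Field F] [Fintype F] [DecidableEq F] [CommRing E] [Fintype E] [Algebra F E]
  (D : QuadraticEtale F E) {ψ : AddChar F ℂ}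

/-- The Weil representation of `SL₂`. -/
noncomputable def weilRep (hψ : ψ ≠ 1) :
    Representation ℂ (Matrix.SpecialLinearGroup (Fin 2) F) (E → ℂ) where
  toFun := D.weilOp ψ
  map_one' := by
    refine LinearMap.ext fun f => funext fun x => ?_
    rw [weilOp_of_eq_zero D ψ (by simp)]
    simp
  map_mul' := D.weilOp_mul hψ

theorem weilRep_upper (hψ : ψ ≠ 1) (b : F) (f : E → ℂ) (x : E) :
    D.weilRep hψ (upper b) f x = ψ (b * D.norm x) * f x := by
  refine (weilOp_of_eq_zero D ψ (g := upper b) (by simp [coe_upper]) f x).trans ?_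
  simp [coe_upper]

theorem weilRep_lower (hψ : ψ ≠ 1) {b : F} (hb : b ≠ 0) (f : E → ℂ) (x : E) :
    D.weilRep hψ (lower b) f x =
      D.sign / Nat.card F * ∑ y, ψ (D.norm (x - y) / b) * f y := by
  refine (weilOp_of_ne_zero D ψ (g := lower b) (by simpa [coe_lower]) f x).trans ?_
  simp [coe_lower, norm_sub]

theorem weilRep_diagonal (hψ : ψ ≠ 1) {a : F} (ha : a ≠ 0) (f : E → ℂ) (x : E) :
    D.weilRep hψ (diagonal a) f x = f (a • x) := by
  refine (weilOp_of_eq_zero D ψ (g := diagonal a) (by simp [coe_diagonal ha]) f x).trans ?_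
  simp [coe_diagonal ha]

theorem weilRep_weyl_neg_one (hψ : ψ ≠ 1) (f : E → ℂ) (x : E) :
    D.weilRep hψ (weyl (-1)) f x = D.sign / Nat.card F * ∑ y, ψ (-D.polar x y) * f y := by
  have h1 : (-1 : F) ≠ 0 := neg_ne_zero.2 one_ne_zero
  refine (weilOp_of_ne_zero D ψ (g := weyl (-1)) (by simp [coe_weyl h1]) f x).trans ?_
  simp [coe_weyl h1]

namespace Character

variable {D} (ω : D.Character) (hψ : ψ ≠ 1)

theorem weilRep_mem (g : Matrix.SpecialLinearGroup (Fin 2) F) {f : E → ℂ}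
    (hf : f ∈ ω.isotypic) : D.weilRep hψ g f ∈ ω.isotypic := ω.weilOp_mem ψ g hf

variable {hψ} {W : Submodule ℂ (E → ℂ)}

/-- Submodules invariant under upper unitriangular matrices are stable under restriction to the
level sets of the norm. -/
theorem restrict_mem (hinv : ∀ b, ∀ f ∈ W, D.weilRep hψ (upper b) f ∈ W) (n : F) {f : E → ℂ}
    (hf : f ∈ W) : (fun x => if D.norm x = n then f x else 0) ∈ W := by
  have hq : (Nat.card F : ℂ) ≠ 0 := by simp [Nat.card_eq_fintype_card]
  have : (fun x => if D.norm x = n then f x else 0) =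
      (Nat.card F : ℂ)⁻¹ • ∑ b, ψ (-(b * n)) • D.weilRep hψ (upper b) f := by
    funext x
    have h1 : ∀ b, (ψ (-(b * n)) • D.weilRep hψ (upper b) f) x =
        ψ ((D.norm x - n) * b) * f x := by
      intro b
      rw [Pi.smul_apply, weilRep_upper, smul_eq_mul, ← mul_assoc, ← AddChar.map_add_eq_mul]
      congr 2
      ring
    rw [Pi.smul_apply, Finset.sum_apply, sum_congr rfl fun b _ => h1 b, ← sum_mul,
      sum_addChar_mul hψ]
    simp only [sub_eq_zero]
    split_ifs
    · simp
    · simp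
  rw [this]
  exact W.smul_mem _ (W.sum_mem fun b _ => W.smul_mem _ (hinv b f hf))

/-- The basis function of the isotypic subspace supported on elements of norm `n`. -/
noncomputable def level (n : F) (x : E) : ℂ := if D.norm x = n then ω x else 0

theorem restrict_eq_smul_level {f : E → ℂ} (hf : f ∈ ω.isotypic) {x : E} (hx : D.norm x ≠ 0) :
    (fun y => if D.norm y = D.norm x then f y else 0) = (f x / ω x) • ω.level (D.norm x) := by
  funext y
  rw [Pi.smul_apply, level, smul_eq_mul]
  split_ifs with hy
  · obtain ⟨u, rfl⟩ := D.isUnit_of_norm_ne_zero hx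
    have hk : D.norm (↑u⁻¹ * y) = 1 := by
      rw [_root_.map_mul, hy, ← _root_.map_mul, Units.inv_mul, _root_.map_one]
    have h1 := hf (↑u⁻¹ * y) u hk
    have h2 : (↑u⁻¹ * y) * u = y := by rw [mul_right_comm, Units.inv_mul, one_mul]
    have h3 := ω.map_mul (↑u⁻¹ * y) u
    rw [h2] at h1 h3
    rw [h1, h3]
    field_simp [ω.ne_zero hx]
  · simp

theorem level_mem (hinv : ∀ b, ∀ f ∈ W, D.weilRep hψ (upper b) f ∈ W) {f : E → ℂ} (hf : f ∈ W)
    (hf' : f ∈ ω.isotypic) {x : E} (hx : D.norm x ≠ 0) (hfx : f x ≠ 0) :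
    ω.level (D.norm x) ∈ W := by
  have := restrict_mem hinv (D.norm x) hf
  rw [ω.restrict_eq_smul_level hf' hx] at this
  exact (W.smul_mem_iff (div_ne_zero hfx (ω.ne_zero hx))).1 this

/-- A nonzero invariant subspace contains a function not vanishing on some unit. -/
theorem exists_apply_ne_zero (hW : W ≤ ω.isotypic) (hinv : ∀ g, ∀ f ∈ W, D.weilRep hψ g f ∈ W)
    (hW0 : W ≠ ⊥) : ∃ f ∈ W, ∃ x, D.norm x ≠ 0 ∧ f x ≠ 0 := by
  by_contra! hcon
  have hU : ∀ b, ∀ f ∈ W, D.weilRep hψ (upper b) f = f := by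
    intro b f hf
    funext x
    rw [weilRep_upper]
    by_cases hx : D.norm x = 0
    · simp [hx]
    · rw [hcon f hf x hx, mul_zero]
  let H : Subgroup (Matrix.SpecialLinearGroup (Fin 2) F) :=
    { carrier := {g | ∀ f ∈ W, D.weilRep hψ g f = f}
      one_mem' := fun f _ => by simp
      mul_mem' := fun hg hg' f hf => by
        rw [_root_.map_mul, Module.End.mul_apply, hg' f hf, hg f hf]
      inv_mem' := fun {g} hg f hf => by
        conv_lhs => rw [← hg f hf]
        rw [← Module.End.mul_apply, ← _root_.map_mul, inv_mul_cancel, _root_.map_one,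
          Module.End.one_apply] }
  have hH : H = ⊤ := by
    refine eq_top_of_upper_of_lower hU fun b f hf => ?_
    have h1 : (1 : F) ≠ 0 := one_ne_zero
    have h2 : lower b = weyl 1 * upper (-b) * (weyl 1)⁻¹ := by
      rw [weyl_conj_upper h1]
      simp
    rw [h2, _root_.map_mul, _root_.map_mul, Module.End.mul_apply, Module.End.mul_apply,
      hU _ _ (hinv _ f hf), ← Module.End.mul_apply, ← _root_.map_mul, mul_inv_cancel,
      _root_.map_one, Module.End.one_apply]
  obtain ⟨k, hk, hk1⟩ := ω.exists_ne_one
  refine hW0 ((Submodule.eq_bot_iff W).2 fun f hf => funext fun x => ?_)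
  by_cases hx : D.norm x = 0
  · by_cases hx0 : x = 0
    · rw [hx0, ω.apply_zero_of_mem (hW hf)]
      rfl
    · obtain ⟨a, ha⟩ := D.norm_zero_smul x hx hx0 k hk
      have ha0 : a ≠ 0 := by
        rintro rfl
        rw [zero_smul] at ha
        obtain ⟨u, rfl⟩ := D.isUnit_of_norm_ne_zero (x := k) (by simp [hk])
        exact hx0 (u.isUnit.mul_right_eq_zero.1 ha)
      have hg : diagonal a ∈ H := by rw [hH]; trivial
      have h1 := congrFun (hg f hf) x
      rw [weilRep_diagonal D hψ ha0, ← ha, hW hf k x hk] at h1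
      by_contra h0
      exact hk1 (mul_right_cancel₀ h0 (by rw [one_mul, h1]))
  · exact hcon f hf x hx

/-- The norms of the supports of elements of `W`. -/
noncomputable def normSupport (W : Submodule ℂ (E → ℂ)) : Set F :=
  {n | ∃ f ∈ W, ∃ x, D.norm x = n ∧ f x ≠ 0}

theorem ncard_normSupport_le (hinv : ∀ b, ∀ f ∈ W, D.weilRep hψ (upper b) f ∈ W) :
    (normSupport (D := D) W).ncard ≤ Module.finrank ℂ W := by
  classical
  have h : ∀ n : normSupport (D := D) W, ∃ f : W, (∃ x, f.1 x ≠ 0 ∧ D.norm x = n) ∧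
      ∀ x, D.norm x ≠ n → f.1 x = 0 := by
    rintro ⟨n, f, hf, x, hx, hfx⟩
    exact ⟨⟨_, restrict_mem hinv n hf⟩, ⟨x, by simp [hx, hfx], hx⟩, fun y hy => if_neg hy⟩
  choose e hx he using h
  choose x hx using hx
  have hli : LinearIndependent ℂ e := by
    rw [Fintype.linearIndependent_iff]
    intro c hc n
    have h1 := congrFun (congrArg Subtype.val hc) (x n)
    rw [AddSubmonoidClass.coe_finsetSum, Finset.sum_apply, sum_eq_single n] at h1
    · exact (mul_eq_zero.1 h1).resolve_right (hx n).1
    · intro m _ hm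
      have := he m (x n) fun h => hm (Subtype.ext (h.symm.trans (hx n).2))
      simp [this]
    · exact fun h => absurd (mem_univ _) h
  rw [← Nat.card_coe_set_eq, Nat.card_eq_fintype_card]
  exact hli.fintype_card_le_finrank

theorem mul_sq_mem_normSupport (hinv : ∀ g, ∀ f ∈ W, D.weilRep hψ g f ∈ W) {n a : F} (ha : a ≠ 0)
    (hn : n ∈ normSupport (D := D) W) : n * a ^ 2 ∈ normSupport (D := D) W := by
  obtain ⟨f, hf, x, rfl, hfx⟩ := hn
  refine ⟨_, hinv (diagonal a⁻¹) f hf, a • x, by rw [norm_smul, mul_comm], ?_⟩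
  rwa [weilRep_diagonal D hψ (inv_ne_zero ha), inv_smul_smul₀ ha]

theorem card_le_two_mul_ncard (hinv : ∀ g, ∀ f ∈ W, D.weilRep hψ g f ∈ W) {n : F} (hn0 : n ≠ 0)
    (hn : n ∈ normSupport (D := D) W) :
    Nat.card F - 1 ≤ 2 * (normSupport (D := D) W \ {0}).ncard := by
  have h := card_le_mul_card_image (f := fun a : F => n * a ^ 2) (univ.erase 0) 2 (by
    intro b hb
    obtain ⟨a, -, rfl⟩ := mem_image.1 hb
    refine (card_le_card (t := {a, -a}) fun c hc => ?_).trans card_le_two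
    have := mul_left_cancel₀ hn0 (mem_filter.1 hc).2
    simpa using sq_eq_sq_iff_eq_or_eq_neg.1 this)
  rw [card_erase_of_mem (mem_univ _), card_univ, ← Nat.card_eq_fintype_card] at h
  refine h.trans (Nat.mul_le_mul_left _ ?_)
  rw [← Set.ncard_coe_finset]
  refine Set.ncard_le_ncard ?_
  intro b hb
  obtain ⟨a, ha, rfl⟩ := mem_image.1 (mem_coe.1 hb)
  have ha0 := ne_of_mem_erase ha
  exact ⟨mul_sq_mem_normSupport hinv ha0 hn, mul_ne_zero hn0 (pow_ne_zero 2 ha0)⟩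

theorem sum_level {n : F} : ∑ y, ω.level n y = 0 := by
  obtain ⟨k, hk, hk1⟩ := ω.exists_ne_one
  obtain ⟨u, rfl⟩ := D.isUnit_of_norm_ne_zero (x := k) (by simp [hk])
  have h := Equiv.sum_comp (Units.mulLeft u) (ω.level n)
  have h1 : ∀ y, ω.level n (Units.mulLeft u y) = ω u * ω.level n y := by
    intro y
    rw [Units.mulLeft_apply, level, level, _root_.map_mul, hk, one_mul, map_mul, mul_ite, mul_zero]
  rw [sum_congr rfl fun y _ => h1 y, ← mul_sum] at h
  by_contra h0
  exact hk1 (mul_right_cancel₀ h0 (by rw [h, one_mul]))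

/-- If the sum of `ω` over some section of a norm fibre does not vanish, then the support of an
invariant subspace meets a punctured line. -/
theorem exists_smul_norm_mem (hinv : ∀ g, ∀ f ∈ W, D.weilRep hψ g f ∈ W) {n τ : F} {x : E}
    (hn : ω.level n ∈ W) (hsum : ∑ y with D.polar x y = τ, ω.level n y ≠ 0) :
    ∃ c : F, c ≠ 0 ∧ D.norm (c • x) ∈ normSupport (D := D) W := by
  by_contra! hcon
  have hq : (Nat.card F : ℂ) ≠ 0 := by simp [Nat.card_eq_fintype_card]
  have hs : (D.sign : ℂ) ≠ 0 := by
    have : (D.sign : ℂ) ^ 2 = 1 := by exact_mod_cast congrArg (Int.cast : ℤ → ℂ) D.sign_sq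
    rintro h
    simp [h] at this
  have h1 : ∀ c : F, ∑ y, ψ (-(c * D.polar x y)) * ω.level n y = 0 := by
    intro c
    by_cases hc : c = 0
    · simp [hc, sum_level]
    · by_contra h0
      refine hcon c hc ⟨_, hinv (weyl (-1)) _ hn, c • x, rfl, ?_⟩
      rw [weilRep_weyl_neg_one]
      simp only [polar_smul_left]
      exact mul_ne_zero (div_ne_zero hs hq) h0
  have h2 : ∑ c, ψ (c * τ) * ∑ y, ψ (-(c * D.polar x y)) * ω.level n y = 0 := by simp [h1]
  simp_rw [mul_sum] at h2
  rw [sum_comm] at h2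
  have h3 : ∀ y, ∑ c, ψ (c * τ) * (ψ (-(c * D.polar x y)) * ω.level n y) =
      Nat.card F * if D.polar x y = τ then ω.level n y else 0 := by
    intro y
    have h4 : ∀ c, ψ (c * τ) * (ψ (-(c * D.polar x y)) * ω.level n y) =
        ψ ((τ - D.polar x y) * c) * ω.level n y := by
      intro c
      rw [← mul_assoc, ← AddChar.map_add_eq_mul]
      congr 2
      ring
    rw [sum_congr rfl fun c _ => h4 c, ← sum_mul, sum_addChar_mul hψ]
    simp only [sub_eq_zero, eq_comm (a := τ)]
    split_ifs <;> simp
  rw [sum_congr rfl fun y _ => h3 y, ← mul_sum, ← sum_filter] at h2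
  exact hsum ((mul_eq_zero.1 h2).resolve_left hq)

theorem exists_level_mem (hW : W ≤ ω.isotypic) (hinv : ∀ g, ∀ f ∈ W, D.weilRep hψ g f ∈ W)
    (hW0 : W ≠ ⊥) : ∃ n, n ≠ 0 ∧ n ∈ normSupport (D := D) W ∧ ω.level n ∈ W := by
  obtain ⟨f, hf, x, hx, hfx⟩ := ω.exists_apply_ne_zero hW hinv hW0
  exact ⟨_, hx, ⟨f, hf, x, rfl, hfx⟩, ω.level_mem (fun b => hinv _) hf (hW hf) hx hfx⟩

theorem zero_mem_normSupport (hsign : D.sign = 1) (hinv : ∀ g, ∀ f ∈ W, D.weilRep hψ g f ∈ W)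
    {n : F} (hn0 : n ≠ 0) (hn : ω.level n ∈ W) : 0 ∈ normSupport (D := D) W := by
  obtain ⟨x, hx0, hx, hxy⟩ := D.exists_isotropic hsign
  obtain ⟨y, rfl⟩ := D.norm_surjective n
  obtain ⟨c, hc, h⟩ := ω.exists_smul_norm_mem hinv (τ := D.polar x y) (x := x) hn (by
    rw [sum_eq_single y]
    · simpa [level] using ω.ne_zero hn0
    · intro z hz hzy
      rw [level, if_neg]
      exact fun hzn => hzy (hxy z y (hzn ▸ hn0) hzn (mem_filter.1 hz).2)
    · simp)
  rwa [norm_smul, hx, mul_zero] at h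

/-- Nonzero invariant subspaces of the isotypic part have at least half its dimension. -/
theorem finrank_isotypic_le (hW : W ≤ ω.isotypic) (hinv : ∀ g, ∀ f ∈ W, D.weilRep hψ g f ∈ W)
    (hW0 : W ≠ ⊥) : Module.finrank ℂ ω.isotypic ≤ 2 * Module.finrank ℂ W := by
  obtain ⟨n, hn0, hn, hnW⟩ := ω.exists_level_mem hW hinv hW0
  have h1 := card_le_two_mul_ncard hinv hn0 hn
  have h2 := ncard_normSupport_le (D := D) (W := W) fun b => hinv (upper b)
  have h3 := ω.finrank_isotypic
  have h4 : 1 ≤ Nat.card F := Nat.card_pos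
  rcases mul_self_eq_one_iff.1 ((sq _).symm.trans D.sign_sq) with hs | hs
  · have := Set.ncard_sdiff_singleton_add_one (ω.zero_mem_normSupport hs hinv hn0 hnW)
    omega
  · have := Set.ncard_le_ncard (Set.sdiff_subset (s := normSupport (D := D) W) (t := {0}))
    omega

theorem sum_level_section_ne_zero (hω : ∀ x, D.norm x ≠ 0 → ω x ^ 3 = 1) {x y : E}
    (hx : D.norm x ≠ 0) (hy : D.norm y ≠ 0) :
    ∑ z with D.polar x z = D.polar x y, ω.level (D.norm y) z ≠ 0 := by
  obtain ⟨u, rfl⟩ := D.isUnit_of_norm_ne_zero hx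
  obtain ⟨z, hz⟩ : ∃ z, u * D.conj z = D.conj u * y :=
    ⟨D.conj (↑u⁻¹ * (D.conj u * y)), by rw [D.conj_conj, Units.mul_inv_cancel_left]⟩
  have hconj : D.conj (u * D.conj y) = D.conj u * y := by rw [_root_.map_mul, D.conj_conj]
  have hNz : D.norm z = D.norm y := by
    have := congrArg D.norm hz
    rw [_root_.map_mul, _root_.map_mul, norm_conj, norm_conj] at this
    exact mul_left_cancel₀ hx this
  have hz0 : D.norm z ≠ 0 := hNz ▸ hy
  have hmem : D.polar u z = D.polar u y := by rw [polar, hz, ← hconj, tr_conj, polar]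
  have hother : ∀ t, D.polar u t = D.polar u y → t ≠ y → t ≠ z → ω.level (D.norm y) t = 0 := by
    intro t ht hty htz
    refine if_neg fun hN => ?_
    rcases D.eq_or_eq_conj (u * D.conj t) (u * D.conj y)
      (by rw [_root_.map_mul, _root_.map_mul, norm_conj, norm_conj, hN]) ht with h | h
    · exact hty (D.conj.injective (u.isUnit.mul_left_cancel h))
    · exact htz (D.conj.injective (u.isUnit.mul_left_cancel (h.trans (hconj.trans hz.symm))))
  have hly : ω.level (D.norm y) y = ω y := if_pos rfl
  have hlz : ω.level (D.norm y) z = ω z := if_pos hNz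
  by_cases hzy : z = y
  · rw [sum_eq_single y, hly]
    · exact ω.ne_zero hy
    · exact fun t ht hty => hother t (mem_filter.1 ht).2 hty (hzy ▸ hty)
    · simp
  · rw [sum_eq_add y z (Ne.symm hzy), hly, hlz]
    · intro h0
      have hm := congrArg ω.toHom hz
      rw [_root_.map_mul, _root_.map_mul] at hm
      have h1 : ω y * ω z = ω u ^ 2 := by
        have e1 := ω.mul_map_conj hx
        have e2 := ω.mul_map_conj hz0
        linear_combination -(ω u * ω z) * hm - ω z * ω y * e1 + ω u ^ 2 * e2
      have h2 : ω y ^ 2 = -ω u ^ 2 := by linear_combination ω y * h0 - h1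
      have h3 : (ω y ^ 3) ^ 2 = -(ω u ^ 3) ^ 2 := by
        linear_combination (ω y ^ 4 - ω y ^ 2 * ω u ^ 2 + ω u ^ 4) * h2
      rw [hω y hy, hω u hx] at h3
      norm_num at h3
    · exact fun t ht h => hother t (mem_filter.1 ht).2 h.1 h.2
    · simp
    · exact fun h => (h (by simp [hmem])).elim

/-- For `ω` of order three, invariant subspaces of the isotypic part are large. -/
theorem card_le_finrank_add_one (hω : ∀ x, D.norm x ≠ 0 → ω x ^ 3 = 1) (hW : W ≤ ω.isotypic)
    (hinv : ∀ g, ∀ f ∈ W, D.weilRep hψ g f ∈ W) (hW0 : W ≠ ⊥) :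
    Nat.card F ≤ Module.finrank ℂ W + 1 := by
  obtain ⟨n, hn0, hn, hnW⟩ := ω.exists_level_mem hW hinv hW0
  have h2 := ncard_normSupport_le (D := D) (W := W) fun b => hinv (upper b)
  have h3 : ({0}ᶜ : Set F) ⊆ normSupport (D := D) W := by
    intro n' hn'
    obtain ⟨x, rfl⟩ := D.norm_surjective n'
    change D.norm x ≠ 0 at hn'
    obtain ⟨y, rfl⟩ := D.norm_surjective n
    obtain ⟨c, hc, h⟩ := ω.exists_smul_norm_mem hinv (τ := D.polar x y) (x := x) hnW
      (ω.sum_level_section_ne_zero hω hn' hn0)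
    have := mul_sq_mem_normSupport hinv (inv_ne_zero hc) h
    rwa [norm_smul, inv_pow, mul_right_comm, mul_inv_cancel₀ (pow_ne_zero 2 hc), one_mul] at this
  have h4 := Set.ncard_le_ncard h3
  have h5 := Set.ncard_add_ncard_compl ({0} : Set F)
  rw [Set.ncard_singleton] at h5
  omega

end Character

end QuadraticEtale

section ProjectiveSpecialLinear

open Matrix Matrix.SpecialLinearGroup

variable {F : Type} [Field F]

/-- The projection `SL₂ → PSL₂`. -/
abbrev toPSL : SpecialLinearGroup (Fin 2) F →* ProjectiveSpecialLinearGroup (Fin 2) F :=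
  QuotientGroup.mk' _

theorem mem_center_iff_eq_or_eq_neg {A : SpecialLinearGroup (Fin 2) F} :
    A ∈ Subgroup.center (SpecialLinearGroup (Fin 2) F) ↔ A.1 = 1 ∨ A.1 = -1 := by
  rw [mem_center_iff]
  simp only [Fintype.card_fin, sq_eq_one_iff]
  constructor
  · rintro ⟨r, rfl | rfl, h⟩
    · exact .inl (by rw [← h, map_one])
    · exact .inr (by rw [← h, map_neg, map_one])
  · rintro (h | h)
    · exact ⟨1, .inl rfl, by rw [h, map_one]⟩
    · exact ⟨-1, .inr rfl, by rw [h, map_neg, map_one]⟩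

theorem toPSL_eq_iff {A B : SpecialLinearGroup (Fin 2) F} :
    toPSL A = toPSL B ↔ A.1 = B.1 ∨ A.1 = -B.1 := by
  rw [eq_comm, QuotientGroup.mk'_apply, QuotientGroup.mk'_apply, QuotientGroup.eq,
    mem_center_iff_eq_or_eq_neg]
  have key (C : SpecialLinearGroup (Fin 2) F) : (B⁻¹ * A).1 = C.1 ↔ A.1 = (B * C).1 := by
    have h : B⁻¹ * A = C ↔ A = B * C := inv_mul_eq_iff_eq_mul
    exact ⟨fun e => congrArg Subtype.val (h.1 (Subtype.ext e)),
      fun e => congrArg Subtype.val (h.2 (Subtype.ext e))⟩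
  have h1 := key 1
  have h2 := key (-1)
  rw [mul_one] at h1
  have h3 : (B * -1).1 = -B.1 := by simp
  rw [h3] at h2
  exact or_congr h1 h2

theorem toPSL_surjective : Function.Surjective (toPSL (F := F)) := QuotientGroup.mk'_surjective _

theorem toPSL_upper_injective : Function.Injective fun x : F => toPSL (upper x) := by
  intro x y h
  rcases toPSL_eq_iff.1 h with h | h
  · simpa [coe_upper] using congr_fun₂ h 0 1
  · have h0 := congr_fun₂ h 0 0
    have h1 := congr_fun₂ h 0 1
    simp [coe_upper] at h0 h1
    linear_combination h1 - y * h0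

theorem toPSL_lower_injective : Function.Injective fun x : F => toPSL (lower x) := by
  intro x y h
  rcases toPSL_eq_iff.1 h with h | h
  · simpa [coe_lower] using congr_fun₂ h 1 0
  · have h0 := congr_fun₂ h 0 0
    have h1 := congr_fun₂ h 1 0
    simp [coe_lower] at h0 h1
    linear_combination h1 - y * h0

/-- The subgroup of upper unitriangular elements of `PSL₂`. -/
def upperSubgroup (F : Type) [Field F] : Subgroup (ProjectiveSpecialLinearGroup (Fin 2) F) where
  carrier := {g | ∃ x, g = toPSL (upper x)}
  mul_mem' := by
    rintro _ _ ⟨x, rfl⟩ ⟨y, rfl⟩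
    exact ⟨x + y, by rw [upper_add, map_mul]⟩
  one_mem' := ⟨0, by rw [upper_zero, map_one]⟩
  inv_mem' := by
    rintro _ ⟨x, rfl⟩
    exact ⟨-x, by rw [upper_neg, map_inv]⟩

theorem mul_upper_eq {A : SpecialLinearGroup (Fin 2) F} (x : F) :
    (A * upper x).1 = !![A.1 0 0, A.1 0 0 * x + A.1 0 1; A.1 1 0, A.1 1 0 * x + A.1 1 1] := by
  change A.1 * (upper x).1 = _
  rw [coe_upper, eta_fin_two A.1]
  simp

theorem upper_mul_eq {A : SpecialLinearGroup (Fin 2) F} (x : F) :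
    (upper x * A).1 = !![A.1 0 0 + x * A.1 1 0, A.1 0 1 + x * A.1 1 1; A.1 1 0, A.1 1 1] := by
  change (upper x).1 * A.1 = _
  rw [coe_upper, eta_fin_two A.1]
  simp

theorem det_eq_one (A : SpecialLinearGroup (Fin 2) F) :
    A.1 0 0 * A.1 1 1 - A.1 0 1 * A.1 1 0 = 1 := by
  rw [← det_fin_two, A.2]

theorem mem_upperSubgroup_of_commute {x : F} (hx : x ≠ 0)
    {g : ProjectiveSpecialLinearGroup (Fin 2) F} (h : g * toPSL (upper x) = toPSL (upper x) * g) :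
    g ∈ upperSubgroup F := by
  obtain ⟨A, rfl⟩ := toPSL_surjective g
  have hdet := det_eq_one A
  have key : A.1 1 0 = 0 ∧ A.1 0 0 = A.1 1 1 := by
    rw [← map_mul, ← map_mul, toPSL_eq_iff, mul_upper_eq, upper_mul_eq] at h
    rcases h with h | h
    · have h0 := congr_fun₂ h 0 0
      have h1 := congr_fun₂ h 0 1
      simp at h0 h1
      refine ⟨h0.resolve_left hx, mul_right_cancel₀ hx ?_⟩
      linear_combination h1
    · have h0 := congr_fun₂ h 0 0
      have h1 := congr_fun₂ h 0 1
      have h2 := congr_fun₂ h 1 0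
      have h3 := congr_fun₂ h 1 1
      simp at h0 h1 h2 h3
      by_cases htwo : (2 : F) = 0
      · have h00 : A.1 1 0 = 0 := mul_left_cancel₀ hx (by linear_combination h0 - A.1 0 0 * htwo)
        refine ⟨h00, mul_right_cancel₀ hx ?_⟩
        linear_combination h1 - (A.1 0 1 + x * A.1 1 1) * htwo
      · have h00 : A.1 1 0 = 0 := mul_left_cancel₀ htwo (by linear_combination h2)
        have h01 : A.1 0 0 = 0 :=
          mul_left_cancel₀ htwo (by linear_combination h0 - x * h00)
        rw [h00, h01] at hdet
        simp at hdet
  obtain ⟨h1, h2⟩ := key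
  rw [h1, ← h2, mul_zero, sub_zero, mul_self_eq_one_iff] at hdet
  rcases hdet with hd | hd
  · refine ⟨A.1 0 1, toPSL_eq_iff.2 (.inl ?_)⟩
    rw [eta_fin_two A.1, coe_upper, h1, ← h2, hd]
    simp
  · refine ⟨-A.1 0 1, toPSL_eq_iff.2 (.inr ?_)⟩
    rw [eta_fin_two A.1, coe_upper, h1, ← h2, hd]
    simp

theorem isPGroup_upperSubgroup (p : ℕ) [Fact p.Prime] [CharP F p] :
    IsPGroup p (upperSubgroup F) := by
  rintro ⟨_, x, rfl⟩
  refine ⟨1, Subtype.ext ?_⟩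
  have h (n : ℕ) : upper x ^ n = upper (n * x) := by
    induction n with
    | zero => simp [upper_zero]
    | succ n ih => rw [pow_succ, ih, ← upper_add, Nat.cast_succ, add_one_mul]
  change toPSL (upper x) ^ p ^ 1 = 1
  rw [← map_pow, pow_one, h, CharP.cast_eq_zero, zero_mul, upper_zero, map_one]

theorem toPSL_upper_ne_one {x : F} (hx : x ≠ 0) : toPSL (upper x) ≠ 1 := fun h =>
  hx (toPSL_upper_injective (by simp only [h, upper_zero, map_one]))

/-- Every `p`-subgroup of `PSL₂` in defining characteristic is conjugate to a group of upper
unitriangular elements. -/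
theorem exists_conj_mem_upperSubgroup [Finite F] (p : ℕ) [Fact p.Prime] [CharP F p]
    {H : Subgroup (ProjectiveSpecialLinearGroup (Fin 2) F)} (hH : IsPGroup p H) :
    ∃ g, ∀ h ∈ H, ∃ x, h = g * toPSL (upper x) * g⁻¹ := by
  obtain ⟨Q, hQ⟩ := (isPGroup_upperSubgroup (F := F) p).exists_le_sylow
  obtain ⟨R, hR⟩ := hH.exists_le_sylow
  have hone : toPSL (upper (1 : F)) ∈ Q := hQ ⟨1, rfl⟩
  have : Nontrivial (Q : Subgroup (ProjectiveSpecialLinearGroup (Fin 2) F)) :=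
    ⟨⟨⟨_, hone⟩, 1, fun h => toPSL_upper_ne_one one_ne_zero (congrArg Subtype.val h)⟩⟩
  have := Q.2.center_nontrivial
  obtain ⟨z, hz⟩ := exists_ne (1 : Subgroup.center Q)
  have hcomm (g) (hg : g ∈ Q) : g * z.1.1 = z.1.1 * g :=
    congrArg Subtype.val (Subgroup.mem_center_iff.1 z.2 ⟨g, hg⟩)
  obtain ⟨x, hx⟩ := mem_upperSubgroup_of_commute one_ne_zero (hcomm _ hone).symm
  have hx0 : x ≠ 0 := by
    rintro rfl
    rw [upper_zero, map_one] at hx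
    exact hz (Subtype.ext (Subtype.ext hx))
  have hQU (g) (hg : g ∈ Q) : ∃ x, g = toPSL (upper x) := by
    have := hcomm g hg
    rw [hx] at this
    exact mem_upperSubgroup_of_commute hx0 this
  obtain ⟨g, rfl⟩ := MulAction.exists_smul_eq (ProjectiveSpecialLinearGroup (Fin 2) F) Q R
  refine ⟨g, fun h hh => ?_⟩
  obtain ⟨k, hk, rfl⟩ := hR hh
  obtain ⟨x, rfl⟩ := hQU k hk
  exact ⟨x, rfl⟩

theorem exists_upper_lower_of_mulAut [Finite F] (p : ℕ) [Fact p.Prime] [CharP F p]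
    (φ : MulAut (ProjectiveSpecialLinearGroup (Fin 2) F)) :
    ∃ s, ∃ α β : F → F, (∀ x, φ (toPSL (upper x)) = s * toPSL (upper (α x)) * s⁻¹) ∧
      ∀ y, φ (toPSL (lower y)) = s * toPSL (lower (β y)) * s⁻¹ := by
  have hU := isPGroup_upperSubgroup (F := F) p
  obtain ⟨g₁, h₁⟩ := exists_conj_mem_upperSubgroup p (hU.map φ.toMonoidHom)
  obtain ⟨g₂, h₂⟩ := exists_conj_mem_upperSubgroup p
    (hU.map (φ * MulAut.conj (toPSL (weyl 1))).toMonoidHom)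
  choose α hα using fun x => h₁ _ ⟨_, ⟨x, rfl⟩, rfl⟩
  choose β hβ using fun x => h₂ _ ⟨_, ⟨-x, rfl⟩, rfl⟩
  change ∀ x, φ (toPSL (upper x)) = _ at hα
  replace hβ (x) : φ (toPSL (lower x)) = g₂ * toPSL (upper (β x)) * g₂⁻¹ := by
    rw [← hβ]
    change _ = φ (toPSL (weyl 1) * toPSL (upper (-x)) * (toPSL (weyl 1))⁻¹)
    rw [← map_mul, ← map_inv, ← map_mul, weyl_conj_upper one_ne_zero]
    simp
  obtain ⟨A, hA⟩ := toPSL_surjective (g₁⁻¹ * g₂)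
  obtain rfl : g₂ = g₁ * toPSL A := by rw [hA, mul_inv_cancel_left]
  have hdet := det_eq_one A
  by_cases hc : A.1 1 0 = 0
  · exfalso
    have hconj (b : F) : A * upper b = upper (b * (A.1 0 0) ^ 2) * A := by
      apply Subtype.ext
      rw [mul_upper_eq, upper_mul_eq, hc]
      rw [hc, mul_zero, sub_zero] at hdet
      have h : A.1 0 0 * b + A.1 0 1 = A.1 0 1 + b * A.1 0 0 ^ 2 * A.1 1 1 := by
        linear_combination (-A.1 0 0 * b) * hdet
      rw [h]
      simp
    have hcomm : φ (toPSL (lower 1)) * φ (toPSL (upper 1)) =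
        φ (toPSL (upper 1)) * φ (toPSL (lower 1)) := by
      have h : φ (toPSL (lower 1)) =
          g₁ * toPSL (upper (β 1 * (A.1 0 0) ^ 2)) * g₁⁻¹ := by
        rw [hβ, mul_assoc g₁, ← map_mul, hconj, map_mul]
        group
      have h' : toPSL (upper (β 1 * (A.1 0 0) ^ 2)) * toPSL (upper (α 1)) =
        toPSL (upper (α 1)) * toPSL (upper (β 1 * (A.1 0 0) ^ 2)) := by
        rw [← map_mul, ← map_mul, ← upper_add, ← upper_add, add_comm]
      rw [h, hα]
      simp only [mul_assoc, inv_mul_cancel_left]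
      rw [← mul_assoc (toPSL _) (toPSL _), h', mul_assoc]
    rw [← map_mul φ, ← map_mul φ] at hcomm
    obtain ⟨x, hx⟩ := mem_upperSubgroup_of_commute one_ne_zero (φ.injective hcomm)
    rcases toPSL_eq_iff.1 hx with h | h <;>
    · have := congr_fun₂ h 1 0
      simp [coe_upper, coe_lower] at this
  · obtain ⟨r, t, e, ht, rfl⟩ : ∃ r t e, t ≠ 0 ∧ A = upper r * weyl t * upper e := by
      refine ⟨A.1 0 0 / A.1 1 0, -(A.1 1 0)⁻¹, A.1 1 1 / A.1 1 0,
        neg_ne_zero.2 (inv_ne_zero hc), Subtype.ext ?_⟩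
      rw [mul_upper_eq]
      simp only [upper_mul_eq, coe_weyl (neg_ne_zero.2 (inv_ne_zero hc))]
      have h : A.1 0 1 = A.1 0 0 / A.1 1 0 * A.1 1 0 * (A.1 1 1 / A.1 1 0) - (A.1 1 0)⁻¹ := by
        field_simp
        linear_combination -hdet
      refine (eta_fin_two _).trans ?_
      rw [h]
      simp [hc, mul_div_cancel₀, sub_eq_add_neg]
    refine ⟨g₁ * toPSL (upper r), α, fun y => -(β y / t ^ 2), fun x => ?_, fun y => ?_⟩
    · have h : upper r * upper (α x) = upper (α x) * upper r := by
        rw [← upper_add, ← upper_add, add_comm]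
      have h' : toPSL (upper r) * toPSL (upper (α x)) = toPSL (upper (α x)) * toPSL (upper r) := by
        rw [← map_mul, h, map_mul]
      rw [hα, mul_assoc g₁ (toPSL (upper r)), h']
      group
    · have h : upper e * upper (β y) = upper (β y) * upper e := by
        rw [← upper_add, ← upper_add, add_comm]
      have h' : toPSL (upper e) * toPSL (upper (β y)) = toPSL (upper (β y)) * toPSL (upper e) := by
        rw [← map_mul, h, map_mul]
      rw [hβ, ← weyl_conj_upper ht]
      simp only [map_mul, map_inv]
      rw [mul_assoc g₁, mul_assoc _ (toPSL (upper e)), h']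
      group

/-- An automorphism of `PSL₂` stabilizing both unipotent subgroups is induced by a diagonal matrix
and a field automorphism. -/
theorem exists_ringEquiv_of_upper_lower [Finite F]
    {φ : MulAut (ProjectiveSpecialLinearGroup (Fin 2) F)} {α β : F → F}
    (hα : ∀ x, φ (toPSL (upper x)) = toPSL (upper (α x)))
    (hβ : ∀ x, φ (toPSL (lower x)) = toPSL (lower (β x))) :
    ∃ (σ : F ≃+* F) (a : F), a ≠ 0 ∧ (∀ x, α x = a * σ x) ∧ ∀ x, β x = σ x / a := by
  have hadd (x y) : α (x + y) = α x + α y := toPSL_upper_injective (by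
    simp only [← hα, upper_add, map_mul])
  have hadd' (x y) : β (x + y) = β x + β y := toPSL_lower_injective (by
    simp only [← hβ, lower_add, map_mul])
  have h0 : α 0 = 0 := by simpa using hadd 0 0
  have hneg (x) : β (-x) = -β x := by
    have h0' : β 0 = 0 := by simpa using hadd' 0 0
    rw [eq_neg_iff_add_eq_zero, ← hadd', neg_add_cancel, h0']
  have hinj : Function.Injective α := fun x y h =>
    toPSL_upper_injective (φ.injective (by simp only [hα, h]))
  have hne {x} (hx : x ≠ 0) : α x ≠ 0 := fun h => hx (hinj (h.trans h0.symm))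
  have key {x} (hx : x ≠ 0) (b) : β (b / x ^ 2) = α b / (α x) ^ 2 := by
    set X := α x with hX
    have hX0 : X ≠ 0 := hne hx
    set Y := β (-x⁻¹) with hY
    have hn (b) : toPSL (upper X * lower Y * upper X * upper (α b)) =
        toPSL (lower (-β (b / x ^ 2)) * (upper X * lower Y * upper X)) := by
      have h := weyl_conj_upper hx b
      rw [mul_inv_eq_iff_eq_mul, weyl] at h
      have h' := congrArg (fun g => φ (toPSL g)) h
      simpa only [map_mul, hα, hβ, ← hneg] using h'
    have hL (B : F) : (upper X * lower Y * upper X * upper B).1 =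
        !![1 + X * Y, (1 + X * Y) * B + X * (2 + X * Y); Y, Y * B + 1 + X * Y] := by
      change (upper X).1 * (lower Y).1 * (upper X).1 * (upper B).1 = _
      simp only [coe_upper, coe_lower]
      ext i j
      fin_cases i <;> fin_cases j <;> simp <;> ring
    have hR (C : F) : (lower C * (upper X * lower Y * upper X)).1 =
        !![1 + X * Y, X * (2 + X * Y); C * (1 + X * Y) + Y,
          C * (X * (2 + X * Y)) + 1 + X * Y] := by
      change (lower C).1 * ((upper X).1 * (lower Y).1 * (upper X).1) = _
      simp only [coe_upper, coe_lower]
      ext i j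
      fin_cases i <;> fin_cases j <;> simp <;> ring
    simp only [toPSL_eq_iff, hL, hR] at hn
    have ht : 1 + X * Y = 0 := by
      rcases hn 1 with h | h
      · have h1 := congr_fun₂ h 0 1
        simpa [hne one_ne_zero] using h1
      · have h1 := congr_fun₂ h 0 0
        have h2 := congr_fun₂ h 0 1
        simp at h1 h2
        by_cases htwo : (2 : F) = 0
        · refine mul_right_cancel₀ (hne one_ne_zero) ?_
          linear_combination h2 - X * (2 + X * Y) * htwo
        · exact mul_left_cancel₀ htwo (by linear_combination h1)
    have hY' : Y = -X⁻¹ := by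
      field_simp
      linear_combination ht
    have h3 : Y * α b = -β (b / x ^ 2) * X := by
      rcases hn b with h | h
      · have h1 := congr_fun₂ h 1 1
        simp at h1
        linear_combination h1 - β (b / x ^ 2) * X * ht
      · have h1 := congr_fun₂ h 1 1
        have h2 := congr_fun₂ h 0 1
        have h4 : (2 : F) * X = 0 := by
          simp at h2
          linear_combination h2 - (α b + 2 * X) * ht
        have h5 : (2 : F) = 0 := (mul_eq_zero.1 h4).resolve_right hX0
        simp at h1
        linear_combination h1 + (β (b / x ^ 2) * X - 2) * ht + (β (b / x ^ 2) * X) * h5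
    rw [hY'] at h3
    field_simp at h3 ⊢
    linear_combination h3
  set a := α 1 with ha
  have ha0 : a ≠ 0 := hne one_ne_zero
  have hβα (x) : β x = α x / a ^ 2 := by simpa using key one_ne_zero x
  have hsq (c x) : α (c * x ^ 2) / a = α c / a * (α x / a) ^ 2 := by
    by_cases hx : x = 0
    · simp [hx, h0]
    · have h := key hx (c * x ^ 2)
      rw [mul_div_cancel_right₀ _ (pow_ne_zero 2 hx), hβα] at h
      have := hne hx
      field_simp at h ⊢
      linear_combination -h
  have hone : α 1 / a = 1 := div_self ha0
  have hmul (x y) : α (x * y) / a = α x / a * (α y / a) := by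
    by_cases htwo : (2 : F) = 0
    · obtain ⟨z, rfl⟩ := FiniteField.isSquare_of_char_two (F := F)
        (ringChar.eq_iff.2 (CharTwo.of_one_ne_zero_of_two_eq_zero one_ne_zero htwo)) y
      have h := hsq 1 z
      rw [hone, one_mul, one_mul] at h
      rw [← sq, hsq, h]
    · have h := hsq x (y + 1)
      have e : x * (y + 1) ^ 2 = x * y ^ 2 + x * y + x * y + x := by ring
      rw [e, hadd, hadd, hadd, hadd, add_div, add_div, add_div, add_div, hsq, hone] at h
      refine mul_left_cancel₀ htwo ?_
      linear_combination h
  let σ : F →+* F :=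
    { toFun := fun x => α x / a
      map_one' := hone
      map_mul' := hmul
      map_zero' := by simp [h0]
      map_add' := fun x y => by rw [hadd, add_div] }
  refine ⟨RingEquiv.ofBijective σ (Finite.injective_iff_bijective.1 σ.injective), a, ha0,
    fun x => ?_, fun x => ?_⟩
  · change _ = a * (α x / a)
    field_simp
  · change _ = α x / a / a
    rw [hβα]
    field_simp

/-- The automorphisms of `PSL₂` over a finite field. -/
theorem exists_ringEquiv_of_mulAut [Finite F] (p : ℕ) [Fact p.Prime] [CharP F p]
    (φ : MulAut (ProjectiveSpecialLinearGroup (Fin 2) F)) :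
    ∃ (s : ProjectiveSpecialLinearGroup (Fin 2) F) (σ : F ≃+* F) (a : F), a ≠ 0 ∧
      (∀ x, φ (toPSL (upper x)) = s * toPSL (upper (a * σ x)) * s⁻¹) ∧
      ∀ x, φ (toPSL (lower x)) = s * toPSL (lower (σ x / a)) * s⁻¹ := by
  obtain ⟨s, α, β, hα, hβ⟩ := exists_upper_lower_of_mulAut p φ
  obtain ⟨σ, a, ha, h, h'⟩ := exists_ringEquiv_of_upper_lower (φ := MulAut.conj s⁻¹ * φ)
    (α := α) (β := β)
    (fun x => by rw [MulAut.mul_apply, hα, MulAut.conj_apply]; group)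
    (fun x => by rw [MulAut.mul_apply, hβ, MulAut.conj_apply]; group)
  exact ⟨s, σ, a, ha, fun x => by rw [hα, h], fun x => by rw [hβ, h']⟩

end ProjectiveSpecialLinear

/-- A group homomorphism extends to the automorphism group if it can be extended compatibly to
automorphisms covering all classes modulo inner automorphisms. -/
theorem exists_mulAut_monoidHom {P M : Type} [Group P] [Group M] (ρ : P →* M)
    (D : Subgroup (MulAut P × M)) (hD : ∀ d ∈ D, ∀ s, d.2 * ρ s * d.2⁻¹ = ρ (d.1 s))
    (hsurj : ∀ φ : MulAut P, ∃ s, ∃ d ∈ D, MulAut.conj s * d.1 = φ)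
    (hone : ∀ d ∈ D, ∀ s, MulAut.conj s * d.1 = 1 → ρ s * d.2 = 1) :
    ∃ Φ : MulAut P →* M, ∀ s, Φ (MulAut.conj s) = ρ s := by
  choose s d hd h using hsurj
  have key (t t' : P) (e e' : MulAut P × M) (he : e ∈ D) (he' : e' ∈ D)
      (heq : MulAut.conj t * e.1 = MulAut.conj t' * e'.1) : ρ t * e.2 = ρ t' * e'.2 := by
    have := hone _ (D.mul_mem he (D.inv_mem he')) (t'⁻¹ * t) (by
      rw [Prod.fst_mul, Prod.fst_inv, map_mul, map_inv, mul_assoc, ← mul_assoc (MulAut.conj t),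
        heq]
      group)
    rw [map_mul, map_inv, Prod.snd_mul, Prod.snd_inv, mul_assoc, inv_mul_eq_one, ← mul_assoc] at this
    rw [eq_mul_inv_iff_mul_eq.1 this]
  refine ⟨MonoidHom.mk' (fun φ => ρ (s φ) * (d φ).2) fun φ φ' => ?_, fun t => ?_⟩
  · have h1 := key (s (φ * φ')) (s φ * (d φ).1 (s φ')) (d (φ * φ')) (d φ * d φ') (hd _)
      (D.mul_mem (hd _) (hd _)) (by
        rw [h]
        nth_rw 1 [← h φ, ← h φ']
        ext x
        simp [mul_assoc])
    rw [h1, map_mul, ← hD _ (hd φ), Prod.snd_mul]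
    group
  · have h1 := key (s (MulAut.conj t)) t (d (MulAut.conj t)) 1 (hd _) D.one_mem (by
      rw [h, Prod.fst_one, mul_one])
    exact h1.trans (by rw [Prod.snd_one, mul_one])

section Matrices

open Matrix (SpecialLinearGroup eta_fin_two)

variable {F : Type} [Field F]

theorem mul_lower_eq {A : SpecialLinearGroup (Fin 2) F} (x : F) :
    (A * lower x).1 = !![A.1 0 0 + A.1 0 1 * x, A.1 0 1; A.1 1 0 + A.1 1 1 * x, A.1 1 1] := by
  change A.1 * (lower x).1 = _
  rw [coe_lower, eta_fin_two A.1]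
  simp

theorem lower_mul_eq {A : SpecialLinearGroup (Fin 2) F} (x : F) :
    (lower x * A).1 = !![A.1 0 0, A.1 0 1; x * A.1 0 0 + A.1 1 0, x * A.1 0 1 + A.1 1 1] := by
  change (lower x).1 * A.1 = _
  rw [coe_lower, eta_fin_two A.1]
  simp

theorem diagonal_inv {a : F} (ha : a ≠ 0) : (diagonal a)⁻¹ = diagonal a⁻¹ := by
  refine inv_eq_of_mul_eq_one_right (Subtype.ext ?_)
  change (diagonal a).1 * (diagonal a⁻¹).1 = _
  rw [coe_diagonal ha, coe_diagonal (inv_ne_zero ha)]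
  simp [ha, Matrix.one_fin_two]

theorem diagonal_mul_upper {a : F} (ha : a ≠ 0) (b : F) :
    diagonal a * upper b = upper (a ^ 2 * b) * diagonal a := by
  apply Subtype.ext
  rw [mul_upper_eq, upper_mul_eq, coe_diagonal ha]
  simp
  field_simp

theorem eq_diagonal_of_conj {g : Matrix.SpecialLinearGroup (Fin 2) F} {b c : F}
    (hb : toPSL (g * upper 1) = toPSL (upper b * g))
    (hc : toPSL (g * lower 1) = toPSL (lower c * g)) : ∃ a, a ≠ 0 ∧ g = diagonal a := by
  have hdet := det_eq_one g
  have h10 : g.1 1 0 = 0 := by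
    rw [toPSL_eq_iff, mul_upper_eq, upper_mul_eq] at hb
    rcases hb with h | h
    · simpa using congr_fun₂ h 1 1
    · have h1 := congr_fun₂ h 1 0
      have h2 := congr_fun₂ h 1 1
      simp at h1 h2
      by_cases htwo : (2 : F) = 0
      · linear_combination h2 - g.1 1 1 * htwo
      · exact mul_left_cancel₀ htwo (by linear_combination h1)
  have h01 : g.1 0 1 = 0 := by
    rw [toPSL_eq_iff, mul_lower_eq, lower_mul_eq] at hc
    rcases hc with h | h
    · simpa using congr_fun₂ h 0 0
    · have h1 := congr_fun₂ h 0 1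
      have h2 := congr_fun₂ h 0 0
      simp at h1 h2
      by_cases htwo : (2 : F) = 0
      · linear_combination h2 - g.1 0 0 * htwo
      · exact mul_left_cancel₀ htwo (by linear_combination h1)
  rw [h01, zero_mul, sub_zero] at hdet
  have h0 := left_ne_zero_of_mul_eq_one hdet
  refine ⟨g.1 0 0, h0, Subtype.ext ?_⟩
  rw [coe_diagonal h0, ← eq_inv_of_mul_eq_one_right hdet]
  nth_rw 1 [Matrix.eta_fin_two g.1, h10, h01]

end Matrices

namespace QuadraticEtale

open Finset

variable {F E : Type} [Field F] [Fintype F] [CommRing E] [Fintype E] [Algebra F E]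
  {D : QuadraticEtale F E} {ψ : AddChar F ℂ}

namespace Character

section ProjRep

variable [DecidableEq F] (ω : D.Character) (hψ : ψ ≠ 1)

/-- The action of `PSL₂` on the `ω`-isotypic part of the Weil representation. -/
noncomputable def projRep :
    Matrix.ProjectiveSpecialLinearGroup (Fin 2) F →* (Module.End ℂ ω.isotypic)ˣ :=
  QuotientGroup.lift _ (MonoidHom.toHomUnits
    { toFun := fun g => (D.weilRep hψ g).restrict fun _ hf => ω.weilRep_mem hψ g hf
      map_one' := by
        ext f : 2
        simp
      map_mul' := fun g h => by
        ext f : 2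
        simp }) (by
    intro A hA
    have hA' : A = 1 ∨ A = diagonal (-1) := by
      rcases mem_center_iff_eq_or_eq_neg.1 hA with h | h
      · exact .inl (Subtype.ext h)
      · refine .inr (Subtype.ext ?_)
        rw [h, coe_diagonal (neg_ne_zero.2 one_ne_zero)]
        ext i j
        fin_cases i <;> fin_cases j <;> simp
    rcases hA' with rfl | rfl
    · exact _root_.map_one _
    · ext f x
      refine (D.weilRep_diagonal hψ (neg_ne_zero.2 one_ne_zero) _ _).trans ?_
      have h1 : D.norm (algebraMap F E (-1)) = 1 := by rw [norm_algebraMap]; simp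
      change f.1 (_ • x) = f.1 x
      rw [Algebra.smul_def, f.2 _ _ h1, ω.map_algebraMap _ (neg_ne_zero.2 one_ne_zero), one_mul])

theorem coe_projRep (g : Matrix.SpecialLinearGroup (Fin 2) F) (f : ω.isotypic) :
    (((ω.projRep hψ (toPSL g)).1 f : ω.isotypic) : E → ℂ) = D.weilRep hψ g f := rfl

end ProjRep

variable (ω : D.Character)

/-- Ring automorphisms preserving the quadratic algebra structure and the character. -/
structure IsCompatible (τ : E ≃+* E) (σ : F ≃+* F) : Prop where
  map_algebraMap : ∀ a, τ (algebraMap F E a) = algebraMap F E (σ a)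
  map_conj : ∀ x, τ (D.conj x) = D.conj (τ x)
  map_char : ∀ x, ω (τ x) = ω x

namespace IsCompatible

variable {ω} {τ τ' : E ≃+* E} {σ σ' : F ≃+* F}

theorem norm_map (h : ω.IsCompatible τ σ) (x : E) : D.norm (τ x) = σ (D.norm x) :=
  D.algebraMap_injective (by
    rw [← D.mul_conj, ← h.map_conj, ← _root_.map_mul τ, D.mul_conj, h.map_algebraMap])

theorem refl : ω.IsCompatible (RingEquiv.refl E) (RingEquiv.refl F) :=
  ⟨fun _ => rfl, fun _ => rfl, fun _ => rfl⟩

theorem trans (h : ω.IsCompatible τ σ) (h' : ω.IsCompatible τ' σ') :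
    ω.IsCompatible (τ.trans τ') (σ.trans σ') :=
  ⟨fun a => by simp [h.map_algebraMap, h'.map_algebraMap],
    fun x => by simp [h.map_conj, h'.map_conj], fun x => by simp [h.map_char, h'.map_char]⟩

theorem symm (h : ω.IsCompatible τ σ) : ω.IsCompatible τ.symm σ.symm :=
  ⟨fun a => by rw [RingEquiv.symm_apply_eq, h.map_algebraMap, RingEquiv.apply_symm_apply],
    fun x => by rw [RingEquiv.symm_apply_eq, h.map_conj, RingEquiv.apply_symm_apply],
    fun x => by rw [← h.map_char, RingEquiv.apply_symm_apply]⟩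

end IsCompatible

/-- The pairs of automorphisms of `PSL₂` and of the isotypic space induced by a unit of the
quadratic algebra and a pair of compatible ring automorphisms. -/
structure IsTwist (φ : MulAut (Matrix.ProjectiveSpecialLinearGroup (Fin 2) F))
    (A : (Module.End ℂ ω.isotypic)ˣ) (c : Eˣ) (τ : E ≃+* E) (σ : F ≃+* F) : Prop where
  isCompatible : ω.IsCompatible τ σ
  apply (f : ω.isotypic) (x : E) : (A.1 f).1 x = (ω c)⁻¹ * f.1 (c * τ x)
  map_upper (x : F) : φ (toPSL (upper x)) = toPSL (upper (σ.symm (x * D.norm c)))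
  map_lower (x : F) : φ (toPSL (lower x)) = toPSL (lower (σ.symm (x / D.norm c)))

theorem norm_unit_ne_zero (c : Eˣ) : D.norm c ≠ 0 := (c.isUnit.map D.norm).ne_zero

/-- The group of twists. -/
def twistSubgroup : Subgroup
    (MulAut (Matrix.ProjectiveSpecialLinearGroup (Fin 2) F) × (Module.End ℂ ω.isotypic)ˣ) where
  carrier := {d | ∃ c τ σ, ω.IsTwist d.1 d.2 c τ σ}
  one_mem' := ⟨1, _, _, .refl, fun f x => by simp [ω.map_one], fun x => by simp, fun x => by simp⟩
  mul_mem' := by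
    rintro ⟨φ, A⟩ ⟨φ', A'⟩ ⟨c, τ, σ, h⟩ ⟨c', τ', σ', h'⟩
    refine ⟨c' * Units.map (τ' : E →* E) c, _, _, h.isCompatible.trans h'.isCompatible,
      fun f x => ?_, fun x => ?_, fun x => ?_⟩
    · change (A.1 (A'.1 f)).1 x = _
      rw [h.apply, h'.apply]
      simp [ω.map_mul, h'.isCompatible.map_char, mul_assoc]
    · change φ (φ' _) = _
      rw [h'.map_upper, h.map_upper]
      simp [h'.isCompatible.norm_map, mul_assoc]
    · change φ (φ' _) = _
      rw [h'.map_lower, h.map_lower]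
      simp [h'.isCompatible.norm_map, div_div]
  inv_mem' := by
    rintro ⟨φ, A⟩ ⟨c, τ, σ, h⟩
    refine ⟨Units.map (τ.symm : E →* E) c⁻¹, _, _, h.isCompatible.symm, fun f x => ?_,
      fun x => ?_, fun x => ?_⟩
    · obtain ⟨f, rfl⟩ : ∃ f', f = A.1 f' := ⟨A⁻¹.1 f, by
        rw [← Module.End.mul_apply, Units.mul_inv, Module.End.one_apply]⟩
      change (A⁻¹.1 (A.1 f)).1 x = _
      rw [← Module.End.mul_apply, Units.inv_mul, h.apply]
      have h1 : ω c * ω (c⁻¹ : Eˣ) = 1 := by rw [← ω.map_mul, Units.mul_inv, ω.map_one]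
      have h0 := left_ne_zero_of_mul_eq_one h1
      simp [h.isCompatible.symm.map_char, eq_inv_of_mul_eq_one_right h1, h0]
    · change φ⁻¹ _ = _
      rw [MulAut.inv_apply, MulEquiv.symm_apply_eq, h.map_upper]
      simp [h.isCompatible.symm.norm_map, norm_unit_ne_zero]
    · change φ⁻¹ _ = _
      rw [MulAut.inv_apply, MulEquiv.symm_apply_eq, h.map_lower]
      simp [h.isCompatible.symm.norm_map, norm_unit_ne_zero]

variable {ω}

theorem IsTwist.conj_projRep [DecidableEq F] (hψ : ψ ≠ 1)
    (hσ : ∀ (σ : F ≃+* F) z, ψ (σ z) = ψ z)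
    {φ : MulAut (Matrix.ProjectiveSpecialLinearGroup (Fin 2) F)}
    {A : (Module.End ℂ ω.isotypic)ˣ} {c : Eˣ} {τ : E ≃+* E} {σ : F ≃+* F}
    (h : ω.IsTwist φ A c τ σ) (s : Matrix.ProjectiveSpecialLinearGroup (Fin 2) F) :
    A * ω.projRep hψ s * A⁻¹ = ω.projRep hψ (φ s) := by
  let H := (((MulAut.conj A).toMonoidHom.comp (ω.projRep hψ)).eqLocus
    ((ω.projRep hψ).comp φ.toMonoidHom)).comap toPSL
  have hc := norm_unit_ne_zero (D := D) c
  suffices hH : H = ⊤ by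
    obtain ⟨g, rfl⟩ := toPSL_surjective s
    exact (hH ▸ Subgroup.mem_top g : g ∈ H)
  refine eq_top_of_upper_of_lower (fun b => ?_) (fun b => ?_)
  · change A * ω.projRep hψ _ * A⁻¹ = ω.projRep hψ (φ _)
    rw [mul_inv_eq_iff_eq_mul, h.map_upper]
    ext f x
    simp only [Units.val_mul, Module.End.mul_apply]
    rw [h.apply, coe_projRep, coe_projRep, weilRep_upper, weilRep_upper, h.apply, mul_left_comm,
      _root_.map_mul D.norm, h.isCompatible.norm_map, ← hσ σ (_ * D.norm x), _root_.map_mul σ,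
      RingEquiv.apply_symm_apply, mul_assoc b]
  · change A * ω.projRep hψ _ * A⁻¹ = ω.projRep hψ (φ _)
    rw [mul_inv_eq_iff_eq_mul, h.map_lower]
    by_cases hb : b = 0
    · simp [hb, lower_zero]
    have hb' : σ.symm (b / D.norm c) ≠ 0 := by simp [hb, hc]
    ext f x
    simp only [Units.val_mul, Module.End.mul_apply]
    rw [h.apply, coe_projRep, coe_projRep, weilRep_lower D hψ hb, weilRep_lower D hψ hb',
      mul_left_comm, mul_sum]
    congr 1
    rw [← Equiv.sum_comp (τ.toEquiv.trans (Units.mulLeft c))]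
    refine sum_congr rfl fun y _ => ?_
    rw [h.apply, mul_left_comm, ← hσ σ (_ / σ.symm _), map_div₀ σ, RingEquiv.apply_symm_apply,
      ← h.isCompatible.norm_map, map_sub τ]
    change ψ (D.norm (c * τ x - c * τ y) / b) * ((ω c)⁻¹ * f.1 (c * τ y)) = _
    rw [← mul_sub, _root_.map_mul, div_div_eq_mul_div, mul_comm (D.norm c)]

variable (ω) in
theorem exists_isTwist {τ : E ≃+* E} {σ : F ≃+* F} (h : ω.IsCompatible τ σ) (c : Eˣ)
    {φ : MulAut (Matrix.ProjectiveSpecialLinearGroup (Fin 2) F)}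
    (hu : ∀ x : F, φ (toPSL (upper x)) = toPSL (upper (σ.symm (x * D.norm c))))
    (hl : ∀ x : F, φ (toPSL (lower x)) = toPSL (lower (σ.symm (x / D.norm c)))) :
    ∃ A, ω.IsTwist φ A c τ σ := by
  have hmem {τ : E ≃+* E} {σ : F ≃+* F} (h : ω.IsCompatible τ σ) (c : E) (f : ω.isotypic) :
      (fun x => (ω c)⁻¹ * f.1 (c * τ x)) ∈ ω.isotypic := by
    intro k x hk
    beta_reduce
    rw [_root_.map_mul, mul_left_comm c, f.2 _ _ (by rw [h.norm_map, hk, _root_.map_one]), h.map_char,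
      mul_left_comm]
  let T {τ : E ≃+* E} {σ : F ≃+* F} (h : ω.IsCompatible τ σ) (c : E) :
      Module.End ℂ ω.isotypic :=
    { toFun := fun f => ⟨_, hmem h c f⟩
      map_add' := fun f f' => by
        ext x
        exact mul_add _ _ _
      map_smul' := fun r f => by
        ext x
        exact mul_left_comm _ _ _ }
  have hc := ω.ne_zero (norm_unit_ne_zero (D := D) c)
  have hc' := ω.ne_zero (norm_unit_ne_zero (D := D) c⁻¹)
  have h1 : ω c * ω (c⁻¹ : Eˣ) = 1 := by rw [← ω.map_mul, Units.mul_inv, ω.map_one]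
  refine ⟨⟨T h c, T h.symm (τ.symm (c⁻¹ : Eˣ)), ?_, ?_⟩, h, fun f x => rfl, hu, hl⟩
  · ext f x
    change (ω c)⁻¹ * ((ω (τ.symm (c⁻¹ : Eˣ)))⁻¹ *
      f.1 (τ.symm (c⁻¹ : Eˣ) * τ.symm (c * τ x))) = f.1 x
    rw [h.symm.map_char, ← mul_assoc, ← mul_inv, h1, ← _root_.map_mul, Units.inv_mul_cancel_left]
    simp
  · ext f x
    change (ω (τ.symm (c⁻¹ : Eˣ)))⁻¹ * ((ω c)⁻¹ *
      f.1 (c * τ (τ.symm (c⁻¹ : Eˣ) * τ.symm x))) = f.1 x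
    rw [h.symm.map_char, ← mul_assoc, ← mul_inv, mul_comm (ω _), h1, ← _root_.map_mul,
      RingEquiv.apply_symm_apply, Units.mul_inv_cancel_left]
    simp

/-- Twists acting on `PSL₂` as inner automorphisms act accordingly on the isotypic space. -/
theorem IsTwist.projRep_mul_eq_one [DecidableEq F] (hψ : ψ ≠ 1)
    (hσ : ∀ (σ : F ≃+* F) z, ψ (σ z) = ψ z)
    {φ : MulAut (Matrix.ProjectiveSpecialLinearGroup (Fin 2) F)}
    {A : (Module.End ℂ ω.isotypic)ˣ} {c : Eˣ} {τ : E ≃+* E} {σ : F ≃+* F}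
    (h : ω.IsTwist φ A c τ σ) {s : Matrix.ProjectiveSpecialLinearGroup (Fin 2) F}
    (hs : MulAut.conj s * φ = 1) : ω.projRep hψ s * A = 1 := by
  have hφ (t) : s * φ t = t * s := by
    have := congrArg (· t) hs
    simpa [mul_inv_eq_iff_eq_mul] using this
  have hcomm (t) : (ω.projRep hψ s * A) * ω.projRep hψ t =
      ω.projRep hψ t * (ω.projRep hψ s * A) := by
    have h1 := mul_inv_eq_iff_eq_mul.1 (h.conj_projRep hψ hσ t)
    rw [mul_assoc, h1, ← mul_assoc, ← _root_.map_mul, hφ, _root_.map_mul, mul_assoc]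
  obtain ⟨g, rfl⟩ := toPSL_surjective s
  have hc0 := norm_unit_ne_zero (D := D) c
  obtain ⟨a, ha, hg⟩ : ∃ a, a ≠ 0 ∧ g⁻¹ = diagonal a := by
    refine eq_diagonal_of_conj (b := σ.symm (1 * D.norm c)) (c := σ.symm (1 / D.norm c)) ?_ ?_
    · rw [_root_.map_mul, _root_.map_mul, ← h.map_upper, map_inv, eq_mul_inv_iff_mul_eq, mul_assoc,
        inv_mul_eq_iff_eq_mul, hφ]
    · rw [_root_.map_mul, _root_.map_mul, ← h.map_lower, map_inv, eq_mul_inv_iff_mul_eq, mul_assoc,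
        inv_mul_eq_iff_eq_mul, hφ]
  obtain rfl := inv_eq_iff_eq_inv.1 hg
  have hx (x : F) : σ.symm (x * D.norm c) = a ^ 2 * x := by
    have h1 := hφ (toPSL (upper x))
    rw [h.map_upper, map_inv, inv_mul_eq_iff_eq_mul, ← mul_assoc, eq_mul_inv_iff_mul_eq,
      ← _root_.map_mul toPSL, ← _root_.map_mul toPSL, diagonal_mul_upper ha,
      _root_.map_mul toPSL, _root_.map_mul toPSL] at h1
    exact toPSL_upper_injective (mul_right_cancel h1)
  have hN : D.norm c = σ (a ^ 2) := by
    rw [← RingEquiv.symm_apply_eq, ← mul_one (a ^ 2), ← hx, one_mul]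
  have hσ1 (x : F) : σ x = x := by
    have := hx (σ x)
    rw [_root_.map_mul, RingEquiv.symm_apply_apply, hN, RingEquiv.symm_apply_apply, mul_comm] at this
    exact (mul_left_cancel₀ (pow_ne_zero 2 ha) this).symm
  have happly (f : ω.isotypic) (x : E) (hx : D.norm x ≠ 0) :
      ((ω.projRep hψ (toPSL (diagonal a)⁻¹) * A).1 f).1 x = f.1 x := by
    obtain ⟨x, rfl⟩ := D.isUnit_of_norm_ne_zero hx
    rw [Units.val_mul, Module.End.mul_apply, diagonal_inv ha, coe_projRep,
      weilRep_diagonal D hψ (inv_ne_zero ha), h.apply]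
    have hτx : c * τ (a⁻¹ • (x : E)) = (a⁻¹ • (c * τ x * (x⁻¹ : Eˣ))) * x := by
      rw [smul_mul_assoc, Units.inv_mul_cancel_right, Algebra.smul_def, _root_.map_mul,
        h.isCompatible.map_algebraMap, hσ1, ← Algebra.smul_def, mul_smul_comm]
    have hN1 : D.norm x * D.norm (x⁻¹ : Eˣ) = 1 := by
      rw [← _root_.map_mul, Units.mul_inv, _root_.map_one]
    have hω1 : ω x * ω (x⁻¹ : Eˣ) = 1 := by rw [← ω.map_mul, Units.mul_inv, ω.map_one]
    rw [hτx, f.2 _ _ ?_, ω.map_smul (inv_ne_zero ha), ω.map_mul, ω.map_mul,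
      h.isCompatible.map_char, mul_assoc (ω c), hω1, mul_one,
      inv_mul_cancel_left₀ (ω.ne_zero hc0)]
    rw [norm_smul, _root_.map_mul, _root_.map_mul, h.isCompatible.norm_map, hσ1, hN, hσ1,
      mul_assoc, hN1, mul_one, inv_pow, inv_mul_cancel₀ (pow_ne_zero 2 ha)]
  set B := ω.projRep hψ (toPSL (diagonal a)⁻¹) * A with hB
  let W : Submodule ℂ (E → ℂ) := (LinearMap.range (B.1 - 1)).map ω.isotypic.subtype
  have hW : W = ⊥ := by
    by_contra hW0
    obtain ⟨_, ⟨_, ⟨f, rfl⟩, rfl⟩, x, hx, hx0⟩ := ω.exists_apply_ne_zero (hψ := hψ)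
      (Submodule.map_subtype_le _ _) (by
        rintro g _ ⟨_, ⟨f, rfl⟩, rfl⟩
        refine ⟨_, ⟨(ω.projRep hψ (toPSL g)).1 f, rfl⟩, ?_⟩
        have h1 := congrArg (fun u => (u.1 f).1) (hcomm (toPSL g))
        rw [LinearMap.sub_apply]
        change (((B * ω.projRep hψ (toPSL g)).1 f).1 - _ : E → ℂ) = _
        rw [hB, h1]
        change _ = D.weilRep hψ g ((B.1 f).1 - f.1)
        rw [map_sub, ← coe_projRep, ← coe_projRep]
        rfl) hW0
    refine hx0 ?_
    change (B.1 f).1 x - f.1 x = 0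
    rw [happly f x hx, sub_self]
  ext f : 3
  have hf : (B.1 - 1) f = 0 := Subtype.ext ((Submodule.mem_bot ℂ).1
    (hW ▸ (⟨_, ⟨f, rfl⟩, rfl⟩ : ((B.1 - 1) f).1 ∈ W)))
  exact congrArg Subtype.val (sub_eq_zero.1 hf)

theorem exists_monoidHom_mulAut [DecidableEq F] (hψ : ψ ≠ 1)
    (hσ : ∀ (σ : F ≃+* F) z, ψ (σ z) = ψ z) (hτ : ∀ σ, ∃ τ, ω.IsCompatible τ σ)
    (p : ℕ) [Fact p.Prime] [CharP F p] :
    ∃ Φ : MulAut (Matrix.ProjectiveSpecialLinearGroup (Fin 2) F) →* (Module.End ℂ ω.isotypic)ˣ,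
      ∀ s, Φ (MulAut.conj s) = ω.projRep hψ s := by
  refine exists_mulAut_monoidHom _ ω.twistSubgroup ?_ ?_ ?_
  · rintro d ⟨c, τ, σ, h⟩ s
    exact h.conj_projRep hψ hσ s
  · intro φ
    obtain ⟨s, σ, a, ha, hu, hl⟩ := exists_ringEquiv_of_mulAut p φ
    obtain ⟨τ, hτ⟩ := hτ σ.symm
    obtain ⟨c, hc⟩ := D.norm_surjective (σ.symm a)
    obtain ⟨c, rfl⟩ := D.isUnit_of_norm_ne_zero (x := c) (by simpa [hc] using ha)
    obtain ⟨A, hA⟩ := ω.exists_isTwist hτ c (φ := MulAut.conj s⁻¹ * φ)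
      (fun x => by
        rw [MulAut.mul_apply, hu, MulAut.conj_apply, hc, RingEquiv.symm_symm, _root_.map_mul,
          RingEquiv.apply_symm_apply, mul_comm a]
        group)
      (fun x => by
        rw [MulAut.mul_apply, hl, MulAut.conj_apply, hc, RingEquiv.symm_symm, map_div₀,
          RingEquiv.apply_symm_apply]
        group)
    exact ⟨s, (MulAut.conj s⁻¹ * φ, A), ⟨c, _, _, hA⟩, by rw [map_inv, mul_inv_cancel_left]⟩
  · rintro d ⟨c, τ, σ, h⟩ s hs
    exact h.projRep_mul_eq_one hψ hσ hs

/-- The isotypic part of the Weil representation extends to all almost simple groups. -/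
theorem exists_representation [DecidableEq F] (hψ : ψ ≠ 1)
    (hσ : ∀ (σ : F ≃+* F) z, ψ (σ z) = ψ z) (hτ : ∀ σ, ∃ τ, ω.IsCompatible τ σ)
    (p : ℕ) [Fact p.Prime] [CharP F p] {G : Type} [Group G] {S : Subgroup G} [S.Normal]
    (e : S ≃* Matrix.ProjectiveSpecialLinearGroup (Fin 2) F) :
    ∃ π : Representation ℂ G ω.isotypic, ∀ g, ∃ s, ∀ f, (π s f).1 = D.weilRep hψ g f.1 := by
  obtain ⟨Φ, hΦ⟩ := ω.exists_monoidHom_mulAut hψ hσ hτ p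
  refine ⟨(Units.coeHom _).comp
    (Φ.comp ((MulAut.congr e).toMonoidHom.comp MulAut.conjNormal)), fun g => ?_⟩
  refine ⟨e.symm (toPSL g), fun f => ?_⟩
  have h : MulAut.congr e (MulAut.conjNormal (e.symm (toPSL g) : G)) = MulAut.conj (toPSL g) := by
    ext x
    rw [MulAut.conj_apply]
    change e (MulAut.conjNormal (e.symm (toPSL g) : G) (e.symm x)) = _
    rw [← e.eq_symm_apply]
    ext
    simp
  change ((Φ (MulAut.congr e (MulAut.conjNormal (e.symm (toPSL g) : G)))).1 f).1 = _
  rw [h, hΦ, coe_projRep]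

end Character

end QuadraticEtale

section Split

namespace QuadraticEtale

variable (F : Type) [Field F] [Fintype F]

/-- The split quadratic étale algebra. -/
def split : QuadraticEtale F (F × F) where
  conj := AlgEquiv.ofRingEquiv (f := RingEquiv.prodComm) fun _ => rfl
  norm := mulMonoidHom
  tr := LinearMap.fst F F F + LinearMap.snd F F F
  sign := 1
  conj_conj _ := rfl
  mul_conj x := Prod.ext rfl (mul_comm _ _)
  add_conj x := Prod.ext rfl (add_comm _ _)
  sign_sq := one_pow 2
  card_eq := by rw [Nat.card_prod, sq]
  card_norm_one := by
    let e : {x : F × F // x.1 * x.2 = 1} ≃ Fˣ :=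
      { toFun := fun x => ⟨x.1.1, x.1.2, x.2, by rw [mul_comm, x.2]⟩
        invFun := fun u => ⟨(u, (u⁻¹ : Fˣ)), u.mul_inv⟩
        left_inv := fun _ => rfl
        right_inv := fun _ => rfl }
    have h := Nat.card_congr e
    rw [Nat.card_units] at h
    refine (congrArg _ h).trans (Nat.cast_pred Nat.card_pos)
  norm_surjective a := ⟨(a, 1), mul_one a⟩
  nondegenerate x h := by
    have h1 : x.1 * 0 + x.2 * 1 = 0 := h (1, 0)
    have h2 : x.1 * 1 + x.2 * 0 = 0 := h (0, 1)
    exact Prod.ext (by simpa using h2) (by simpa using h1)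
  eq_or_eq_conj y z hn ht := by
    replace hn : y.1 * y.2 = z.1 * z.2 := hn
    replace ht : y.1 + y.2 = z.1 + z.2 := ht
    have h : (y.1 - z.1) * (y.1 - z.2) = 0 := by linear_combination y.1 * ht - hn
    rcases mul_eq_zero.1 h with h | h
    · exact .inl (Prod.ext (sub_eq_zero.1 h) (by linear_combination ht - h))
    · exact .inr (Prod.ext (sub_eq_zero.1 h) (show y.2 = z.1 by linear_combination ht - h))
  norm_one_free k x hk hx := by
    replace hk : k.1 * k.2 = 1 := hk
    have h1 : k.1 * x.1 = x.1 := congrArg Prod.fst hx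
    have h2 : k.2 * x.2 = x.2 := congrArg Prod.snd hx
    rcases mul_right_eq_self₀.1 ((mul_comm _ _).trans h1) with h1 | h1
    · exact .inr (Prod.ext h1 (by simpa [h1] using hk))
    rcases mul_right_eq_self₀.1 ((mul_comm _ _).trans h2) with h2 | h2
    · exact .inr (Prod.ext (by simpa [h2] using hk) h2)
    · exact .inl (Prod.ext h1 h2)
  norm_zero_smul x hx _ k _ := by
    rcases mul_eq_zero.1 (show x.1 * x.2 = 0 from hx) with h | h
    · exact ⟨k.2, Prod.ext (by simp [h]) (by simp)⟩
    · exact ⟨k.1, Prod.ext (by simp) (by simp [h])⟩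
  exists_isotropic _ := by
    refine ⟨(1, 0), by simp, mul_zero _, fun y z hy hn ht => ?_⟩
    replace hn : y.1 * y.2 = z.1 * z.2 := hn
    replace hy : y.1 * y.2 ≠ 0 := hy
    replace ht : 1 * y.2 + 0 * y.1 = 1 * z.2 + 0 * z.1 := ht
    have ht : y.2 = z.2 := by linear_combination ht
    rw [← ht] at hn
    exact Prod.ext (mul_right_cancel₀ (right_ne_zero_of_mul hy) hn) ht

variable {F}

/-- The character `χ(x) / χ(y)` of `F × F`. -/
noncomputable def splitCharacter (χ : MulChar F ℂ) (hχ : χ ^ 2 ≠ 1) : (split F).Character where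
  toHom := mulMonoidHom.comp (χ.toMonoidHom.prodMap (χ⁻¹).toMonoidHom)
  map_algebraMap a ha := by
    change χ a * χ⁻¹ a = 1
    rw [← MulChar.mul_apply, mul_inv_cancel, MulChar.one_apply ha.isUnit]
  exists_ne_one := by
    obtain ⟨a, ha⟩ := MulChar.ne_one_iff.1 hχ
    refine ⟨((a : F), (a⁻¹ : Fˣ)), a.mul_inv, ?_⟩
    change χ a * χ⁻¹ (a⁻¹ : Fˣ) ≠ 1
    rwa [MulChar.inv_apply', Units.val_inv_eq_inv_val, inv_inv, ← MulChar.mul_apply, ← sq]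

theorem splitCharacter_apply (χ : MulChar F ℂ) (hχ : χ ^ 2 ≠ 1) (x : F × F) :
    splitCharacter χ hχ x = χ x.1 * χ⁻¹ x.2 := rfl

theorem exists_isCompatible_splitCharacter (χ : MulChar F ℂ) (hχ : χ ^ 2 ≠ 1) (σ : F ≃+* F)
    (h : (∀ a, χ (σ a) = χ a) ∨ ∀ a, χ (σ a) = χ⁻¹ a) :
    ∃ τ, (splitCharacter χ hχ).IsCompatible τ σ := by
  rcases h with h | h
  · refine ⟨σ.prodCongr σ, fun _ => rfl, fun _ => rfl, fun x => ?_⟩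
    change χ (σ _) * χ⁻¹ (σ _) = χ _ * χ⁻¹ _
    simp [MulChar.inv_apply', ← map_inv₀, h]
  · refine ⟨(σ.prodCongr σ).trans RingEquiv.prodComm, fun _ => rfl, fun _ => rfl, fun x => ?_⟩
    change χ (σ _) * χ⁻¹ (σ _) = χ _ * χ⁻¹ _
    simp [MulChar.inv_apply', ← map_inv₀, h, mul_comm]

end QuadraticEtale

end Split

section Field

namespace QuadraticEtale

variable (F K : Type) [Field F] [Fintype F] [Field K] [Fintype K] [Algebra F K]

/-- A quadratic field extension as a quadratic étale algebra. -/
noncomputable def ofField (h : Module.finrank F K = 2) : QuadraticEtale F K :=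
  have hcard : Nat.card K = Nat.card F ^ 2 := by rw [Module.natCard_eq_pow_finrank (K := F), h]
  have hF : 1 < Nat.card F := Finite.one_lt_card
  have hconj (x : K) : FiniteField.frobeniusAlgEquivOfAlgebraic F K x = x ^ Nat.card F := by
    rw [FiniteField.coe_frobeniusAlgEquivOfAlgebraic, Nat.card_eq_fintype_card]
  have hdiv : (Nat.card K - 1) / (Nat.card F - 1) = Nat.card F + 1 := by
    rw [hcard]
    refine Nat.div_eq_of_eq_mul_left (by omega) ?_
    have := Nat.sq_sub_sq (Nat.card F) 1
    rwa [one_pow] at this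
  have hnorm (x : K) : algebraMap F K (Algebra.norm F x) = x ^ (Nat.card F + 1) := by
    rw [FiniteField.algebraMap_norm_eq_pow, hdiv]
  have htrace (x : K) : algebraMap F K (Algebra.trace F K x) = x + x ^ Nat.card F := by
    rw [FiniteField.algebraMap_trace_eq_sum_pow, h, Finset.sum_range_succ, Finset.sum_range_one,
      pow_zero, pow_one, pow_one]
  { conj := FiniteField.frobeniusAlgEquivOfAlgebraic F K
    norm := Algebra.norm F
    tr := Algebra.trace F K
    sign := -1
    conj_conj := fun x => by rw [hconj, hconj, ← pow_mul, ← sq, ← hcard, Nat.card_eq_fintype_card,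
      FiniteField.pow_card]
    mul_conj := fun x => by rw [hconj, hnorm, pow_succ']
    add_conj := fun x => by rw [hconj, htrace]
    sign_sq := by norm_num
    card_eq := hcard
    card_norm_one := by
      let N : Kˣ →* Fˣ := Units.map (Algebra.norm F)
      have hN : Function.Surjective N := fun a => by
        obtain ⟨x, hx⟩ := FiniteField.norm_surjective F K a
        have hx0 : x ≠ 0 := by
          rintro rfl
          exact a.ne_zero (by rw [← hx, Algebra.norm_zero])
        exact ⟨Units.mk0 x hx0, Units.ext hx⟩
      let e : {x : K // Algebra.norm F x = 1} ≃ N.ker :=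
        { toFun := fun x => ⟨Units.mk0 x.1 (by
            intro h0
            simpa [h0] using x.2), Units.ext x.2⟩
          invFun := fun u => ⟨u.1, congrArg Units.val u.2⟩
          left_inv := fun _ => rfl
          right_inv := fun u => Subtype.ext (Units.ext rfl) }
      rw [Nat.card_congr e]
      have h1 := N.ker.card_mul_index
      rw [Subgroup.index_ker, N.range_eq_top.2 hN, Subgroup.card_top, Nat.card_units,
        Nat.card_units, hcard] at h1
      have h2 := Nat.sq_sub_sq (Nat.card F) 1
      rw [one_pow] at h2
      rw [Nat.eq_of_mul_eq_mul_right (by omega) (h1.trans h2)]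
      push_cast
      ring
    norm_surjective := FiniteField.norm_surjective F K
    nondegenerate := fun x hx => by
      refine (traceForm_nondegenerate F K).1 x fun y => ?_
      obtain ⟨z, rfl⟩ := (FiniteField.frobeniusAlgEquivOfAlgebraic F K).surjective y
      exact hx z
    eq_or_eq_conj := fun y z hn ht => by
      have hn := congrArg (algebraMap F K) hn
      have ht := congrArg (algebraMap F K) ht
      rw [hnorm, hnorm] at hn
      rw [htrace, htrace] at ht
      rw [hconj]
      have : (y - z) * (y - z ^ Nat.card F) = 0 := by
        rw [pow_succ, pow_succ] at hn
        linear_combination y * ht - hn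
      exact (mul_eq_zero.1 this).imp sub_eq_zero.1 sub_eq_zero.1
    norm_one_free := fun k x _ hx => by
      rcases eq_or_ne x 0 with h0 | h0
      · exact .inl h0
      · exact .inr (mul_right_cancel₀ h0 (hx.trans (one_mul x).symm))
    norm_zero_smul := fun x hx hx0 => absurd (Algebra.norm_eq_zero_iff.1 hx) hx0
    exists_isotropic := fun h => absurd h (by norm_num) }

variable {F K}

theorem ofField_conj (h : Module.finrank F K = 2) (x : K) :
    (ofField F K h).conj x = x ^ Nat.card F := by
  refine (congr_fun (FiniteField.coe_frobeniusAlgEquivOfAlgebraic F K) x).trans ?_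
  rw [Nat.card_eq_fintype_card]

theorem algebraMap_ofField_norm (h : Module.finrank F K = 2) (x : K) :
    algebraMap F K ((ofField F K h).norm x) = x ^ (Nat.card F + 1) := by
  rw [← mul_conj, ofField_conj, pow_succ']

/-- The character of a quadratic extension given by a multiplicative character. -/
noncomputable def fieldCharacter (h : Module.finrank F K = 2) (χ : MulChar K ℂ) (hχ : χ ^ 2 ≠ 1)
    (hχ' : χ ^ (Nat.card F + 1) = 1) : (ofField F K h).Character where
  toHom := χ.toMonoidHom
  map_algebraMap a ha := by
    obtain ⟨x, rfl⟩ := (ofField F K h).norm_surjective a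
    have hx := (ofField F K h).isUnit_of_norm_ne_zero ha
    rw [algebraMap_ofField_norm]
    change χ _ = 1
    rw [map_pow, ← MulChar.pow_apply' _ (Nat.succ_ne_zero _), hχ', MulChar.one_apply hx]
  exists_ne_one := by
    obtain ⟨a, ha⟩ := MulChar.ne_one_iff.1 hχ
    have hN : (ofField F K h).norm (a : K) ≠ 0 := (a.isUnit.map _).ne_zero
    have hc : (ofField F K h).conj (a : K) ≠ 0 := by simp
    obtain ⟨k, hk⟩ : ∃ k, k * (ofField F K h).conj (a : K) = a := ⟨a / _, div_mul_cancel₀ _ hc⟩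
    refine ⟨k, mul_right_cancel₀ hN ?_, ?_⟩
    · have h1 := congrArg (ofField F K h).norm hk
      rwa [map_mul, norm_conj, ← one_mul ((ofField F K h).norm (a : K)), ← mul_assoc, mul_one] at h1
    · change χ k ≠ 1
      have h2 : (χ ^ (Nat.card F + 1)) a = 1 := by rw [hχ', MulChar.one_apply a.isUnit]
      have h3 := congrArg χ hk
      rw [MulChar.pow_apply' _ (Nat.succ_ne_zero _), pow_succ', ← map_pow] at h2
      rw [map_mul, ofField_conj] at h3
      rw [MulChar.pow_apply' _ two_ne_zero, sq] at ha
      intro hk1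
      rw [hk1, one_mul] at h3
      exact ha (by rw [← h2, h3])

theorem exists_isCompatible_fieldCharacter (h : Module.finrank F K = 2) (χ : MulChar K ℂ)
    (hχ : χ ^ 2 ≠ 1) (hχ' : χ ^ (Nat.card F + 1) = 1) (σ : F ≃+* F) (τ : K ≃+* K)
    (hτ : ∀ a, τ (algebraMap F K a) = algebraMap F K (σ a))
    (h' : (∀ a, χ (τ a) = χ a) ∨ ∀ a, χ (τ a) = χ⁻¹ a) :
    ∃ τ, (fieldCharacter h χ hχ hχ').IsCompatible τ σ := by
  have hconj (x : K) : τ ((ofField F K h).conj x) = (ofField F K h).conj (τ x) := by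
    rw [ofField_conj, ofField_conj, map_pow]
  rcases h' with h' | h'
  · exact ⟨τ, hτ, hconj, h'⟩
  · refine ⟨τ.trans (ofField F K h).conj.toRingEquiv, fun a => ?_, fun x => ?_, fun x => ?_⟩
    · change (ofField F K h).conj (τ _) = _
      rw [hτ, AlgEquiv.commutes]
    · change (ofField F K h).conj (τ _) = (ofField F K h).conj ((ofField F K h).conj (τ _))
      rw [hconj]
    · change χ ((ofField F K h).conj (τ x)) = χ x
      rw [← hconj, h', MulChar.inv_apply_eq_inv', ofField_conj, map_pow]
      rcases eq_or_ne x 0 with rfl | hx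
      · rw [MulChar.map_zero, zero_pow Nat.card_pos.ne', inv_zero]
      have h2 : (χ ^ (Nat.card F + 1)) x = 1 := by rw [hχ', MulChar.one_apply hx.isUnit]
      rw [MulChar.pow_apply' _ (Nat.succ_ne_zero _), pow_succ] at h2
      rw [← eq_inv_of_mul_eq_one_right h2]

end QuadraticEtale

end Field

section Degrees

/-- Automorphisms of a finite field are powers of Frobenius. -/
theorem exists_forall_ringEquiv_apply_eq_pow (p : ℕ) [Fact p.Prime] {F : Type} [Field F] [Finite F]
    [CharP F p] (σ : F ≃+* F) : ∃ i, ∀ x, σ x = x ^ p ^ i := by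
  let := ZMod.algebra F p
  obtain ⟨i, hi⟩ := FiniteField.exists_forall_apply_eq_pow (ZMod p) p F
    (AlgEquiv.ofRingEquiv (f := σ) fun x =>
      RingHom.congr_fun (Subsingleton.elim ((σ : F →+* F).comp (algebraMap (ZMod p) F)) _) x)
  exact ⟨i, fun x => (hi x).trans (by rw [Nat.card_zmod])⟩

theorem MulChar.pow_apply_eq_or_eq_inv {R : Type} [CommMonoid R] {χ : MulChar R ℂ} {m n : ℕ}
    (hχ : χ ^ m = 1) (hn : n ≠ 0) (h : m ∣ n - 1 ∨ m ∣ n + 1) :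
    (∀ a, χ (a ^ n) = χ a) ∨ ∀ a, χ (a ^ n) = χ⁻¹ a := by
  have hpow (a) : χ (a ^ n) = (χ ^ n) a := by rw [MulChar.pow_apply' _ hn, map_pow]
  refine h.imp (fun h a => ?_) (fun h a => ?_)
  · obtain ⟨k, hk⟩ := h
    rw [hpow, show n = m * k + 1 by omega, pow_succ, pow_mul, hχ, one_pow, one_mul]
  · obtain ⟨k, hk⟩ := h
    rw [hpow, eq_inv_of_mul_eq_one_left (a := χ ^ n) (b := χ)
      (by rw [← pow_succ, hk, pow_mul, hχ, one_pow])]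

/-- A primitive additive character of a finite field invariant under all automorphisms. -/
theorem exists_addChar_ne_one (p : ℕ) [Fact p.Prime] (F : Type) [Field F] [Finite F]
    [CharP F p] : ∃ ψ : AddChar F ℂ, ψ ≠ 1 ∧ ∀ (σ : F ≃+* F) z, ψ (σ z) = ψ z := by
  let := ZMod.algebra F p
  refine ⟨(ZMod.stdAddChar (N := p)).compAddMonoidHom (Algebra.trace (ZMod p) F).toAddMonoidHom,
    fun h => ?_, fun σ z => ?_⟩
  · obtain ⟨x, hx⟩ := Algebra.trace_surjective (ZMod p) F 1
    have h1 : ZMod.stdAddChar (Algebra.trace (ZMod p) F x) = 1 := DFunLike.congr_fun h x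
    rw [hx, ← AddChar.map_zero_eq_one (ZMod.stdAddChar (N := p))] at h1
    exact one_ne_zero (ZMod.injective_stdAddChar h1)
  · exact congrArg ZMod.stdAddChar (Algebra.trace_eq_of_algEquiv
      (AlgEquiv.ofRingEquiv (f := σ) fun x => RingHom.congr_fun
        (Subsingleton.elim ((σ : F →+* F).comp (algebraMap (ZMod p) F)) _) x) z)

namespace QuadraticEtale

/-- Existence of characters of prescribed order invariant up to conjugation under all field
automorphisms. -/
theorem exists_character (p : ℕ) [Fact p.Prime] (F : Type) [Field F] [Fintype F] [CharP F p] {m : ℕ}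
    (hm : 3 ≤ m) (hp : ∀ i, m ∣ p ^ i - 1 ∨ m ∣ p ^ i + 1) :
    ∃ (E : Type) (_ : CommRing E) (_ : Fintype E) (_ : Algebra F E) (D : QuadraticEtale F E)
      (ω : D.Character), (∀ x, D.norm x ≠ 0 → ω x ^ m = 1) ∧
      (∀ σ, ∃ τ, ω.IsCompatible τ σ) ∧ (D.sign = 1 ∨ D.sign = -1) ∧
      (m : ℤ) ∣ Nat.card F - D.sign := by
  obtain ⟨n, -, hn⟩ := FiniteField.card F p
  have hn' : Nat.card F = p ^ (n : ℕ) := by rw [Nat.card_eq_fintype_card, hn]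
  have hp0 (i) : p ^ i ≠ 0 := pow_ne_zero _ (Fact.out : p.Prime).ne_zero
  have hζ := Complex.isPrimitiveRoot_exp m (by omega)
  rcases hn' ▸ hp n with h | h
  · obtain ⟨χ, hχ⟩ := MulChar.exists_mulChar_orderOf F (Nat.card_eq_fintype_card (α := F) ▸ h) hζ
    have hχm : χ ^ m = 1 := hχ ▸ pow_orderOf_eq_one χ
    have hχ2 : χ ^ 2 ≠ 1 := pow_ne_one_of_lt_orderOf two_ne_zero (by omega)
    refine ⟨F × F, inferInstance, inferInstance, inferInstance, split F, splitCharacter χ hχ2,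
      fun x hx => ?_, fun σ => ?_, .inl rfl, ?_⟩
    · have hx1 : x.1 ≠ 0 := left_ne_zero_of_mul (show x.1 * x.2 ≠ 0 from hx)
      have hx2 : x.2 ≠ 0 := right_ne_zero_of_mul (show x.1 * x.2 ≠ 0 from hx)
      have hm0 : m ≠ 0 := by omega
      rw [splitCharacter_apply, mul_pow, ← MulChar.pow_apply' _ hm0, ← MulChar.pow_apply' _ hm0,
        inv_pow, hχm, inv_one, MulChar.one_apply hx1.isUnit, MulChar.one_apply hx2.isUnit, one_mul]
    · obtain ⟨i, hi⟩ := exists_forall_ringEquiv_apply_eq_pow p σ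
      refine exists_isCompatible_splitCharacter χ hχ2 σ ?_
      simp only [hi]
      exact MulChar.pow_apply_eq_or_eq_inv hχm (hp0 i) (hp i)
    · have : ((Nat.card F - 1 : ℕ) : ℤ) = Nat.card F - (split F).sign :=
        Nat.cast_pred Nat.card_pos
      rw [← this]
      exact_mod_cast h
  · let K := FiniteField.Extension F p 2
    have hfin : Module.finrank F K = 2 := FiniteField.finrank_extension F p 2
    let : Fintype K := Fintype.ofFinite K
    have hdvd : m ∣ Fintype.card K - 1 := by
      rw [← Nat.card_eq_fintype_card, Module.natCard_eq_pow_finrank (K := F), hfin]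
      have := Nat.sq_sub_sq (Nat.card F) 1
      rw [one_pow] at this
      rw [this]
      exact h.mul_right _
    obtain ⟨χ, hχ⟩ := MulChar.exists_mulChar_orderOf K hdvd hζ
    have hχm : χ ^ m = 1 := hχ ▸ pow_orderOf_eq_one χ
    have hχ2 : χ ^ 2 ≠ 1 := pow_ne_one_of_lt_orderOf two_ne_zero (by omega)
    have hχq : χ ^ (Nat.card F + 1) = 1 := orderOf_dvd_iff_pow_eq_one.1 (hχ ▸ h)
    refine ⟨K, inferInstance, inferInstance, inferInstance, ofField F K hfin,
      fieldCharacter hfin χ hχ2 hχq, fun x hx => ?_, fun σ => ?_, .inr rfl, ?_⟩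
    · change χ x ^ m = 1
      rw [← MulChar.pow_apply' _ (by omega), hχm,
        MulChar.one_apply ((ofField F K hfin).isUnit_of_norm_ne_zero hx)]
    · obtain ⟨i, hi⟩ := exists_forall_ringEquiv_apply_eq_pow p σ
      have : CharP K p := charP_of_injective_algebraMap (algebraMap F K).injective p
      refine exists_isCompatible_fieldCharacter hfin χ hχ2 hχq σ (iterateFrobeniusEquiv K p i)
        (fun a => ?_) ?_
      · rw [iterateFrobeniusEquiv_def, hi, map_pow]
      · simp only [iterateFrobeniusEquiv_def]
        exact MulChar.pow_apply_eq_or_eq_inv hχm (hp0 i) (hp i)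
    · rw [show (ofField F K hfin).sign = -1 from rfl, sub_neg_eq_add]
      exact_mod_cast h

open Module in
/-- Degrees of almost simple groups coming from the isotypic parts of the Weil representation. -/
theorem exists_mem_cd {F E : Type} [Field F] [Fintype F] [CommRing E] [Fintype E] [Algebra F E]
    (D : QuadraticEtale F E) (ω : D.Character) (hτ : ∀ σ, ∃ τ, ω.IsCompatible τ σ)
    (p : ℕ) [Fact p.Prime] [CharP F p] {G : Type} [Group G] [Fintype G] {S : Subgroup G} [S.Normal]
    (e : S ≃* Matrix.ProjectiveSpecialLinearGroup (Fin 2) F) (hcard : 1 < Nat.card F + D.sign) :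
    ∃ d ∈ cd G, ((d : ℤ) = Nat.card F + D.sign ∨ 2 * (d : ℤ) = Nat.card F + D.sign) ∧
      ((∀ x, D.norm x ≠ 0 → ω x ^ 3 = 1) → Nat.card F ≤ d + 1) := by
  classical
  obtain ⟨ψ, hψ, hσ⟩ := exists_addChar_ne_one p F
  obtain ⟨π, hπ⟩ := ω.exists_representation hψ hσ hτ p e
  have hinv (W : Submodule ℂ ω.isotypic) (h : ∀ g, ∀ v ∈ W, π g v ∈ W) (g) (f)
      (hf : f ∈ W.map ω.isotypic.subtype) : D.weilRep hψ g f ∈ W.map ω.isotypic.subtype := by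
    obtain ⟨v, hv, rfl⟩ := hf
    obtain ⟨s, hs⟩ := hπ g
    exact ⟨π s v, h s v hv, hs v⟩
  have hne (W : Submodule ℂ ω.isotypic) (h : W ≠ ⊥) : W.map ω.isotypic.subtype ≠ ⊥ := by
    rw [← Submodule.map_bot ω.isotypic.subtype]
    exact (Submodule.map_injective_of_injective ω.isotypic.injective_subtype).ne h
  have hfin := ω.finrank_isotypic
  have : Nontrivial ω.isotypic := nontrivial_of_finrank_pos (R := ℂ) (by omega)
  obtain ⟨W, hW0, hW, hd, hdim⟩ := exists_mem_cd_of_half_le π fun W hW0 hW => by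
    rw [← Submodule.finrank_map_subtype_eq ω.isotypic W]
    exact ω.finrank_isotypic_le (Submodule.map_subtype_le _ _) (hinv W hW) (hne W hW0)
  refine ⟨_, hd, by omega, fun hω => ?_⟩
  rw [← Submodule.finrank_map_subtype_eq ω.isotypic W]
  exact ω.card_le_finrank_add_one hω (Submodule.map_subtype_le _ _) (hinv W hW) (hne W hW0)

end QuadraticEtale

end Degrees

theorem stmt10 (p f q : ℕ) [hp : Fact p.Prime] (hq : q = p ^ f) (hq7 : 7 ≤ q)
    (G : Type) [Group G] [Fintype G]
    (S : Subgroup G) (hSnormal : S.Normal) (hSsimple : IsSimpleGroup S)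
    (hSnonab : ¬ ∀ x y : S, x * y = y * x)
    (hcent : Subgroup.centralizer (S : Set G) = ⊥)
    (hiso : Nonempty (S ≃* Matrix.ProjectiveSpecialLinearGroup (Fin 2) (GaloisField p f))) :
    (p ≠ 3 → ∃ δ : ℤ, (δ = 1 ∨ δ = -1) ∧ (q : ℤ) ≡ δ [ZMOD 3] ∧
      ∃ d ∈ cd G, (d : ℤ) = (q : ℤ) + δ) ∧
    (p = 3 → ∃ ε : ℤ, (ε = 1 ∨ ε = -1) ∧ (q : ℤ) ≡ ε [ZMOD 4] ∧
      ∃ d ∈ cd G, (2 * (d : ℤ) = (q : ℤ) + ε ∨ (d : ℤ) = (q : ℤ) + ε)) := by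
  have : S.Normal := hSnormal
  obtain ⟨e⟩ := hiso
  have hf : f ≠ 0 := by
    rintro rfl
    rw [pow_zero] at hq
    omega
  let : Fintype (GaloisField p f) := Fintype.ofFinite _
  have hcard : Nat.card (GaloisField p f) = q := by rw [GaloisField.card p f hf, hq]
  refine ⟨fun hp3 => ?_, fun hp3 => ?_⟩
  · obtain ⟨E, _, _, _, D, ω, hω, hτ, hsign, hdvd⟩ :=
      QuadraticEtale.exists_character p (GaloisField p f) (m := 3) le_rfl fun i => by
        have h3 : ¬ 3 ∣ p ^ i := fun h =>
          hp3 ((Nat.prime_dvd_prime_iff_eq Nat.prime_three hp.out).1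
            (Nat.prime_three.dvd_of_dvd_pow h)).symm
        omega
    rw [hcard] at hdvd
    refine ⟨D.sign, hsign, ((Int.modEq_iff_dvd).2 hdvd).symm, ?_⟩
    obtain ⟨d, hd, h, hle⟩ := D.exists_mem_cd ω hτ p e (by omega)
    have := hle hω
    exact ⟨d, hd, by omega⟩
  · obtain ⟨E, _, _, _, D, ω, -, hτ, hsign, hdvd⟩ :=
      QuadraticEtale.exists_character p (GaloisField p f) (m := 4) (by norm_num) fun i => by
        have h2 : Odd (p ^ i) := by
          rw [hp3]
          exact Odd.pow (by decide)
        obtain ⟨k, hk⟩ := h2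
        omega
    rw [hcard] at hdvd
    refine ⟨D.sign, hsign, ((Int.modEq_iff_dvd).2 hdvd).symm, ?_⟩
    obtain ⟨d, hd, h, -⟩ := D.exists_mem_cd ω hτ p e (by omega)
    exact ⟨d, hd, by omega⟩
end

section
/- Let G be a finite group such that the commutator subgroup G' has index 2 in G, G' is isomorphic to S × S for some nonabelian finite simple group S, and G' is the unique minimal normal subgroup of G (every nontrivial normal subgroup of G contains G'). Then for every a ∈ cd(S) with a > 1, both 2a and a² belong to cd(G). -/
open CategoryTheory

section Representations

variable {G : Type} [Group G] {V : Type} [AddCommGroup V] [Module ℂ V] [Module.Finite ℂ V]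

/-- Over `ℂ`, a nonzero representation of a finite group is simple if its commutant consists of
scalars. -/
lemma FDRep.simple_of_commutant [Finite G] [Nontrivial V] (ρ : G →* V →ₗ[ℂ] V)
    (h : ∀ f : V →ₗ[ℂ] V, (∀ g, f * ρ g = ρ g * f) → ∃ c : ℂ, f = c • 1) :
    Simple (FDRep.of ρ) := by
  have : NeZero (Nat.card G : ℂ) := ⟨Nat.cast_ne_zero.2 Nat.card_pos.ne'⟩
  rw [FDRep.simple_iff_end_is_rank_one]
  have h_id : 𝟙 (FDRep.of ρ) ≠ 0 := by
    intro h0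
    obtain ⟨v, hv⟩ := exists_ne (0 : V)
    exact hv (congrArg (fun φ : FDRep.of ρ ⟶ FDRep.of ρ => φ.hom.hom.hom v) h0)
  rw [finrank_eq_one_iff_of_nonzero' _ h_id]
  intro F
  obtain ⟨c, hc⟩ := h F.hom.hom.hom fun g =>
    congrArg (fun φ => φ.hom.hom) (F.comm g)
  refine ⟨c, ?_⟩
  ext v
  exact (congrArg (fun φ : V →ₗ[ℂ] V => φ v) hc).symm

/-- Schur's lemma for endomorphisms of a simple representation. -/
lemma FDRep.commutant_of_simple (V : FDRep ℂ G) [Simple V] (f : V →ₗ[ℂ] V)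
    (hf : ∀ g, f * V.ρ g = V.ρ g * f) : ∃ c : ℂ, f = c • 1 := by
  let F : V ⟶ V := ⟨FGModuleCat.ofHom f, fun g => by
    ext v
    exact congrArg (fun φ : V →ₗ[ℂ] V => φ v) (hf g)⟩
  obtain ⟨c, hc⟩ := (finrank_eq_one_iff_of_nonzero' (𝟙 V) (id_nonzero V)).1
    (finrank_endomorphism_simple_eq_one ℂ V) F
  refine ⟨c, ?_⟩
  ext v
  exact (congrArg (fun φ : V ⟶ V => φ.hom.hom.hom v) hc).symm

end Representations

/-- A homomorphism on a normal subgroup of index two extends to the whole group once a compatible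
image of an element outside the subgroup is given. -/
lemma Subgroup.exists_extension_of_index_eq_two {G M : Type*} [Group G] [Monoid M]
    {N : Subgroup G} [N.Normal] (hN : N.index = 2) {g : G} (hg : g ∉ N) (φ : N →* M) (t : M)
    (h_conj : ∀ n : N, t * φ n = φ (MulAut.conjNormal g n) * t)
    (h_sq : t * t = φ ⟨g * g, Subgroup.mul_self_mem_of_index_two hN g⟩) :
    ∃ F : G →* M, (∀ n : N, F n = φ n) ∧ F g = t := by
  classical
  have hmem : ∀ {a b : G}, a * b ∈ N ↔ (a ∈ N ↔ b ∈ N) :=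
    Subgroup.mul_mem_iff_of_index_two hN
  have hout : ∀ {h : G}, h ∉ N → h * g⁻¹ ∈ N := fun {h} hh => by
    simp [hmem, hh, hg]
  let f : G → M := fun h => if hh : h ∈ N then φ ⟨h, hh⟩ else φ ⟨h * g⁻¹, hout hh⟩ * t
  have f_in : ∀ n : N, f n = φ n := fun n => by simp [f]
  have f_out : ∀ n : N, f (n * g) = φ n * t := fun n => by
    have : (n : G) * g ∉ N := by simp [hmem, hg]
    simp [f, this]
  have cases_out : ∀ h : G, (∃ n : N, h = n) ∨ ∃ n : N, h = n * g := fun h => by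
    by_cases hh : h ∈ N
    · exact .inl ⟨⟨h, hh⟩, rfl⟩
    · exact .inr ⟨⟨h * g⁻¹, hout hh⟩, by simp⟩
  refine ⟨⟨⟨f, by simpa using f_in 1⟩, fun a b => ?_⟩, f_in, by simpa using f_out 1⟩
  change f (a * b) = f a * f b
  rcases cases_out a with ⟨n, rfl⟩ | ⟨n, rfl⟩ <;> rcases cases_out b with ⟨m, rfl⟩ | ⟨m, rfl⟩
  · rw [← Subgroup.coe_mul, f_in, f_in, f_in, map_mul]
  · rw [← mul_assoc, ← Subgroup.coe_mul, f_in, f_out, f_out, map_mul, mul_assoc]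
  · have : (n : G) * g * m = (n * MulAut.conjNormal g m : N) * g := by simp [mul_assoc]
    rw [this, f_out, f_out, f_in, map_mul, mul_assoc, ← h_conj, mul_assoc]
  · have : (n : G) * g * (m * g) = (n * MulAut.conjNormal g m *
        ⟨g * g, Subgroup.mul_self_mem_of_index_two hN g⟩ : N) := by simp [mul_assoc]
    rw [this, f_in, f_out, f_out, map_mul, map_mul, ← h_sq, mul_assoc, ← mul_assoc _ t t, ← h_conj]
    simp only [mul_assoc]

/-- Let `τ` be an automorphism of `S × S`, with `S` nonabelian simple, that does not preserve the
first factor and whose square is conjugation by a `τ`-fixed element `c`. After a change of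
coordinates, `τ` is the swap followed by an inner automorphism of the second factor. -/
lemma exists_coordinates_of_not_preserve_fst {S : Type*} [Group S] [Finite S] [IsSimpleGroup S]
    (hS : ¬ ∀ x y : S, x * y = y * x) (τ : S × S ≃* S × S) (c : S × S)
    (h_sq : ∀ p, τ (τ p) = c * p * c⁻¹) (hc : τ c = c) (h_swap : ∃ x, (τ (x, 1)).2 ≠ 1) :
    ∃ (j : S × S →* S × S) (s : S), Function.Surjective j ∧
      (∀ p, j (τ p) = ((j p).2, s * (j p).1 * s⁻¹)) ∧ j c = (s, s) := by
  have h_center : ∀ z : S, (∀ x, z * x = x * z) → z = 1 := by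
    intro z hz
    have hz' : z ∈ Subgroup.center S := Subgroup.mem_center_iff.2 fun x => (hz x).symm
    rcases (inferInstance : (Subgroup.center S).Normal).eq_bot_or_eq_top with h | h
    · simpa [h] using hz'
    · refine absurd (fun x y => ?_) hS
      exact (Subgroup.mem_center_iff.1 (h ▸ Subgroup.mem_top x : x ∈ Subgroup.center S) y).symm
  let β : S →* S := (MonoidHom.snd S S).comp (τ.toMonoidHom.comp (MonoidHom.inl S S))
  let α : S →* S := (MonoidHom.fst S S).comp (τ.toMonoidHom.comp (MonoidHom.inr S S))
  have hβ_apply : ∀ x, β x = (τ (x, 1)).2 := fun _ => rfl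
  have hα_apply : ∀ y, α y = (τ (1, y)).1 := fun _ => rfl
  have h_comm : ∀ x y, τ (x, 1) * τ (1, y) = τ (1, y) * τ (x, 1) := fun x y => by
    simp [← map_mul]
  have hβ_surj : Function.Surjective β := by
    refine Finite.surjective_of_injective ((MonoidHom.ker_eq_bot_iff β).1 ?_)
    refine (inferInstance : β.ker.Normal).eq_bot_or_eq_top.resolve_right fun h => ?_
    obtain ⟨x, hx⟩ := h_swap
    exact hx (h ▸ Subgroup.mem_top x : x ∈ β.ker)
  have hα : ∀ y, τ (1, y) = (α y, 1) := fun y => by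
    refine Prod.ext rfl (h_center _ fun z => ?_)
    obtain ⟨x, rfl⟩ := hβ_surj z
    exact (congrArg Prod.snd (h_comm x y)).symm
  have hα_surj : Function.Surjective α := by
    refine Finite.surjective_of_injective fun y z hyz => ?_
    have : τ (1, y) = τ (1, z) := by rw [hα, hα, hyz]
    simpa using τ.injective this
  have hβ : ∀ x, τ (x, 1) = (1, β x) := fun x => by
    refine Prod.ext (h_center _ fun z => ?_) rfl
    obtain ⟨y, rfl⟩ := hα_surj z
    exact congrArg Prod.fst (h_comm x y)
  have hτ : ∀ x y, τ (x, y) = (α y, β x) := fun x y => by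
    have : ((x, y) : S × S) = (x, 1) * (1, y) := by simp
    rw [this, map_mul, hα, hβ]
    simp
  obtain ⟨s, t⟩ := c
  have hs : α t = s := by simpa using congrArg Prod.fst ((hτ s t).symm.trans hc)
  have hαβ : ∀ x, α (β x) = s * x * s⁻¹ := fun x => by
    simpa [hτ] using congrArg Prod.fst (h_sq (x, 1))
  refine ⟨(MonoidHom.id S).prodMap α, s, ?_, ?_, ?_⟩
  · exact Function.Surjective.prodMap Function.surjective_id hα_surj
  · rintro ⟨x, y⟩
    simp [hτ, hαβ]
  · simp [hs]

lemma exists_wreath_coordinates (G : Type) [Group G]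
    (hindex : (commutator G).index = 2)
    (S : Type) [Group S] [Finite S] [IsSimpleGroup S]
    (hS : ¬ ∀ x y : S, x * y = y * x)
    (e : commutator G ≃* S × S)
    (hmin : ∀ N : Subgroup G, N.Normal → N ≠ ⊥ → commutator G ≤ N) :
    ∃ (g : G) (ι : commutator G →* S × S) (s : S), g ∉ commutator G ∧ Function.Surjective ι ∧
      (∀ n, ι (MulAut.conjNormal g n) = ((ι n).2, s * (ι n).1 * s⁻¹)) ∧
      ι ⟨g * g, Subgroup.mul_self_mem_of_index_two hindex g⟩ = (s, s) := by
  have hout : ∃ g, g ∉ commutator G := by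
    by_contra! h
    have : commutator G = ⊤ := by ext; simp [h]
    simp [this] at hindex
  obtain ⟨g, hg⟩ := hout
  let τ : S × S ≃* S × S := (e.symm.trans (MulAut.conjNormal g)).trans e
  have hτ : ∀ n, e (MulAut.conjNormal g n) = τ (e n) := fun n => by simp [τ]
  let q : commutator G := ⟨g * g, Subgroup.mul_self_mem_of_index_two hindex g⟩
  have h_sq : ∀ p, τ (τ p) = e q * p * (e q)⁻¹ := fun p => by
    obtain ⟨n, rfl⟩ := e.surjective p
    rw [← hτ, ← hτ, ← map_mul, ← map_inv, ← map_mul]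
    congr 1
    ext
    simp [q, mul_assoc]
  have hc : τ (e q) = e q := by
    rw [← hτ]
    congr 1
    ext
    simp [q, mul_assoc]
  have h_swap : ∃ x, (τ (x, 1)).2 ≠ 1 := by
    by_contra! h
    let A : Subgroup G := (((MonoidHom.snd S S).comp e.toMonoidHom).ker).map (commutator G).subtype
    have hA : ∀ n : commutator G, (n : G) ∈ A ↔ (e n).2 = 1 := fun n =>
      Subgroup.mem_map_iff_mem (commutator G).subtype_injective
    have hA_normal : A.Normal := by
      have h_in : ∀ n ∈ A, ∀ m : commutator G, m * n * (m : G)⁻¹ ∈ A := by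
        rintro _ ⟨n, hn, rfl⟩ m
        have hn' : (e n).2 = 1 := hn
        have := (hA (m * n * m⁻¹)).2 (by simp [hn'])
        simpa using this
      have h_g : ∀ n ∈ A, g * n * g⁻¹ ∈ A := by
        rintro _ ⟨n, hn, rfl⟩
        have hn' : (e n).2 = 1 := hn
        have hen : e n = ((e n).1, 1) := Prod.ext rfl hn'
        have := (hA (MulAut.conjNormal g n)).2 (by rw [hτ, hen]; exact h _)
        simpa using this
      refine ⟨fun n hn h => ?_⟩
      by_cases hh : h ∈ commutator G
      · exact h_in n hn ⟨h, hh⟩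
      · have hm : h * g⁻¹ ∈ commutator G := by
          simp [Subgroup.mul_mem_iff_of_index_two hindex, hh, hg]
        simpa [mul_assoc] using h_in _ (h_g n hn) ⟨h * g⁻¹, hm⟩
    obtain ⟨x, hx⟩ := exists_ne (1 : S)
    have hA_ne : A ≠ ⊥ := by
      intro hbot
      have := (hA (e.symm (x, 1))).2 (by simp)
      rw [hbot, Subgroup.mem_bot, OneMemClass.coe_eq_one] at this
      exact hx (by simpa using this)
    have := (hA (e.symm (1, x))).1 (hmin A hA_normal hA_ne (SetLike.coe_mem _))
    exact hx (by simpa using this)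
  obtain ⟨j, s, hj, hjτ, hjc⟩ := exists_coordinates_of_not_preserve_fst hS τ (e q) h_sq hc h_swap
  refine ⟨g, j.comp e.toMonoidHom, s, hg, hj.comp e.surjective, fun n => ?_, hjc⟩
  change j (e _) = _
  rw [hτ, hjτ]
  rfl

section Wreath

variable {G S : Type} [Group G] [Finite G] [Group S] {N : Subgroup G} [N.Normal]

lemma two_mul_mem_cd (hN : N.index = 2) {g : G} (hg : g ∉ N)
    {ι : N →* S × S} (hι : Function.Surjective ι) {s : S}
    (h_conj : ∀ n, ι (MulAut.conjNormal g n) = ((ι n).2, s * (ι n).1 * s⁻¹))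
    (h_sq : ι ⟨g * g, Subgroup.mul_self_mem_of_index_two hN g⟩ = (s, s))
    {a : ℕ} (ha : a ∈ cd S) (ha1 : 1 < a) : 2 * a ∈ cd G := by
  obtain ⟨V, hV, rfl⟩ := ha
  let φ : S × S →* (V × V →ₗ[ℂ] V × V) :=
    { toFun := fun p => (V.ρ p.1).prodMap (V.ρ p.2)
      map_one' := by ext <;> simp
      map_mul' := fun p q => by ext <;> simp }
  let t : V × V →ₗ[ℂ] V × V :=
    (LinearMap.snd ℂ V V).prod (V.ρ s ∘ₗ LinearMap.fst ℂ V V)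
  have hφ : ∀ x y v w, φ (x, y) (v, w) = (V.ρ x v, V.ρ y w) := fun _ _ _ _ => rfl
  have ht : ∀ v w, t (v, w) = (w, V.ρ s v) := fun _ _ => rfl
  obtain ⟨F, hF, hFg⟩ := Subgroup.exists_extension_of_index_eq_two hN hg (φ.comp ι) t
    (fun n => by
      refine LinearMap.ext fun ⟨v, w⟩ => ?_
      simp only [MonoidHom.comp_apply, Module.End.mul_apply, h_conj]
      rw [← Prod.mk.eta (p := ι n), hφ, ht, ht, hφ]
      simp)
    (by
      refine LinearMap.ext fun ⟨v, w⟩ => ?_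
      simp only [MonoidHom.comp_apply, Module.End.mul_apply, h_sq, hφ, ht])
  have : Nontrivial V := Module.nontrivial_of_finrank_pos (R := ℂ) (by omega)
  refine ⟨FDRep.of F, FDRep.simple_of_commutant F fun f hf => ?_, ?_⟩
  · have hfφ : ∀ x y v w, f (V.ρ x v, V.ρ y w) =
        (V.ρ x (f (v, w)).1, V.ρ y (f (v, w)).2) := fun x y v w => by
      obtain ⟨n, hn⟩ := hι (x, y)
      have := LinearMap.congr_fun (hf n) (v, w)
      rwa [hF, MonoidHom.comp_apply, hn] at this
    have hft : ∀ v w, f (w, V.ρ s v) = t (f (v, w)) := fun v w => by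
      have := LinearMap.congr_fun (hf g) (v, w)
      rwa [hFg] at this
    have h_zero : ∀ k : V →ₗ[ℂ] V, (∀ x v, V.ρ x (k v) = k v) → (∀ x v, k (V.ρ x v) = k v) →
        k = 0 := by
      intro k hk hk'
      obtain ⟨c, rfl⟩ := FDRep.commutant_of_simple V k fun x => by ext v; simp [hk, hk']
      by_contra hc
      have hc0 : c ≠ 0 := fun h => hc (by simp [h])
      have hρ : ∀ x, V.ρ x = 1 := fun x => by
        ext v
        simpa [hc0] using hk' x v
      have h_one : Module.finrank ℂ (V →ₗ[ℂ] V) ≤ 1 := finrank_le_one 1 fun k' => by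
        obtain ⟨d, hd⟩ := FDRep.commutant_of_simple V k' fun x => by simp [hρ]
        exact ⟨d, hd.symm⟩
      rw [Module.finrank_linearMap] at h_one
      nlinarith
    have h11 := FDRep.commutant_of_simple V (LinearMap.fst ℂ V V ∘ₗ f ∘ₗ LinearMap.inl ℂ V V)
      fun x => by
        ext v
        simpa using congrArg Prod.fst (hfφ x 1 v 0)
    have h22 := FDRep.commutant_of_simple V (LinearMap.snd ℂ V V ∘ₗ f ∘ₗ LinearMap.inr ℂ V V)
      fun x => by
        ext v
        simpa using congrArg Prod.snd (hfφ 1 x 0 v)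
    have h12 := h_zero (LinearMap.fst ℂ V V ∘ₗ f ∘ₗ LinearMap.inr ℂ V V)
      (fun x v => by simpa using (congrArg Prod.fst (hfφ x 1 0 v)).symm)
      (fun x v => by simpa using congrArg Prod.fst (hfφ 1 x 0 v))
    have h21 := h_zero (LinearMap.snd ℂ V V ∘ₗ f ∘ₗ LinearMap.inl ℂ V V)
      (fun x v => by simpa using (congrArg Prod.snd (hfφ 1 x v 0)).symm)
      (fun x v => by simpa using congrArg Prod.snd (hfφ x 1 v 0))
    obtain ⟨c, hc⟩ := h11
    obtain ⟨d, hd⟩ := h22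
    have hfl : ∀ v, f (v, 0) = (c • v, 0) := fun v =>
      Prod.ext (LinearMap.congr_fun hc v) (LinearMap.congr_fun h21 v)
    have hfr : ∀ w, f (0, w) = (0, d • w) := fun w =>
      Prod.ext (LinearMap.congr_fun h12 w) (LinearMap.congr_fun hd w)
    have hcd : c = d := by
      obtain ⟨v, hv⟩ := exists_ne (0 : V)
      have := congrArg Prod.fst (hft 0 v)
      simp only [map_zero, hfl, hfr, ht] at this
      exact smul_left_injective ℂ hv this
    refine ⟨c, LinearMap.ext fun ⟨v, w⟩ => ?_⟩
    have : ((v, w) : V × V) = (v, 0) + (0, w) := by simp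
    rw [this, map_add, hfl, hfr, hcd]
    simp
  · change Module.finrank ℂ (V × V) = _
    rw [Module.finrank_prod, two_mul]

open scoped TensorProduct in
lemma sq_mem_cd [Finite S] (hN : N.index = 2) {g : G} (hg : g ∉ N)
    {ι : N →* S × S} (hι : Function.Surjective ι) {s : S}
    (h_conj : ∀ n, ι (MulAut.conjNormal g n) = ((ι n).2, s * (ι n).1 * s⁻¹))
    (h_sq : ι ⟨g * g, Subgroup.mul_self_mem_of_index_two hN g⟩ = (s, s))
    {a : ℕ} (ha : a ∈ cd S) : a ^ 2 ∈ cd G := by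
  obtain ⟨V, hV, rfl⟩ := ha
  let φ : S × S →* (V ⊗[ℂ] V →ₗ[ℂ] V ⊗[ℂ] V) :=
    Representation.tprod (V.ρ.comp (MonoidHom.fst S S)) (V.ρ.comp (MonoidHom.snd S S))
  have hφ : ∀ p v w, φ p (v ⊗ₜ w) = V.ρ p.1 v ⊗ₜ V.ρ p.2 w := fun _ _ _ => rfl
  have hφ_simple : Simple (FDRep.of φ) := by
    have := Fintype.ofFinite S
    have h_norm := (FDRep.simple_iff_char_is_norm_one V).1 hV
    have h_char : ∀ p, (FDRep.of φ).character p = V.character p.1 * V.character p.2 := fun p =>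
      congrFun (Representation.char_tensor (V.ρ.comp (MonoidHom.fst S S))
        (V.ρ.comp (MonoidHom.snd S S))) p
    rw [FDRep.simple_iff_char_is_norm_one, Nat.card_prod, Nat.cast_mul, ← h_norm,
      Fintype.sum_mul_sum, Fintype.sum_prod_type]
    refine Finset.sum_congr rfl fun x _ => Finset.sum_congr rfl fun y _ => ?_
    rw [h_char, h_char]
    simp only [Prod.fst_inv, Prod.snd_inv]
    ring
  let t : V ⊗[ℂ] V →ₗ[ℂ] V ⊗[ℂ] V :=
    (V.ρ s).lTensor V ∘ₗ (TensorProduct.comm ℂ V V).toLinearMap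
  have ht : ∀ v w, t (v ⊗ₜ w) = w ⊗ₜ V.ρ s v := fun _ _ => rfl
  obtain ⟨F, hF, -⟩ := Subgroup.exists_extension_of_index_eq_two hN hg (φ.comp ι) t
    (fun n => by
      refine TensorProduct.ext' fun v w => ?_
      simp only [MonoidHom.comp_apply, Module.End.mul_apply, h_conj, hφ, ht]
      simp)
    (by
      refine TensorProduct.ext' fun v w => ?_
      simp only [MonoidHom.comp_apply, Module.End.mul_apply, h_sq, hφ, ht])
  have : Nontrivial V := by
    by_contra h
    rw [not_nontrivial_iff_subsingleton] at h
    refine id_nonzero V ?_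
    ext v
    exact Subsingleton.elim (α := V) _ _
  refine ⟨FDRep.of F, FDRep.simple_of_commutant F fun f hf => ?_, ?_⟩
  · refine FDRep.commutant_of_simple (FDRep.of φ) f fun p => ?_
    obtain ⟨n, rfl⟩ := hι p
    have := hf n
    rwa [hF] at this
  · change Module.finrank ℂ (V ⊗[ℂ] V) = _
    rw [Module.finrank_tensorProduct, sq]

end Wreath

theorem stmt13 (G : Type) [Group G] [Fintype G]
    (hindex : (commutator G).index = 2)
    (S : Type) [Group S] [Fintype S] (hSsimple : IsSimpleGroup S)
    (hSnonab : ¬ ∀ x y : S, x * y = y * x)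
    (hiso : Nonempty ((commutator G) ≃* S × S))
    (hmin : ∀ N : Subgroup G, N.Normal → N ≠ ⊥ → commutator G ≤ N) :
    ∀ a ∈ cd S, 1 < a → 2 * a ∈ cd G ∧ a ^ 2 ∈ cd G := by
  obtain ⟨e⟩ := hiso
  obtain ⟨g, ι, s, hg, hι, h_conj, h_sq⟩ :=
    exists_wreath_coordinates G hindex S hSnonab e hmin
  exact fun a ha ha1 => ⟨two_mul_mem_cd hindex hg hι h_conj h_sq ha ha1,
    sq_mem_cd hindex hg hι h_conj h_sq ha⟩
end

section
/- For every integer n ≥ 5, k(S_n) = 2·k(A_n) − 3·p_s(n), where k(G) denotes the number of conjugacy classes of a finite group G and p_s(n) denotes the number of self-conjugate partitions of n. -/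
/-- The number of self-conjugate partitions of `n`, i.e. Young diagrams with `n` cells
fixed by transposition. -/
noncomputable def selfConjugatePartitions (n : ℕ) : ℕ :=
  Nat.card {μ : YoungDiagram // μ.card = n ∧ μ.transpose = μ}

open Subgroup in
/-- By orbit-stabilizer, the centralizer orders of the elements satisfying a conjugation-invariant
predicate sum to the group order times the number of conjugacy classes satisfying it. -/
theorem sum_card_centralizer_eq_card_mul_card_conjClasses {G : Type*} [Group G] [Fintype G]
    (p : G → Prop) [DecidablePred p] (hp : ∀ g h, IsConj g h → p g → p h) :
    ∑ g : G, (if p g then Nat.card (centralizer {g}) else 0) =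
      Nat.card G * Nat.card {c : ConjClasses G // ∃ g, ConjClasses.mk g = c ∧ p g} := by
  classical
  rw [← Finset.sum_fiberwise (s := Finset.univ) (g := ConjClasses.mk), Nat.card_eq_fintype_card
    (α := {c : ConjClasses G // _}), Fintype.card_subtype, mul_comm, ← smul_eq_mul,
    ← Finset.sum_const, Finset.sum_filter]
  refine Finset.sum_congr rfl fun c _ ↦ ?_
  have hc (g : G) : Nat.card (centralizer {g}) * Nat.card (ConjClasses.mk g).carrier =
      Nat.card G := by
    rw [nat_card_centralizer_nat_card_stabilizer, ← ConjAct.orbit_eq_carrier_conjClasses,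
      Nat.card_coe_set_eq, ← MulAction.index_stabilizer, mul_comm, index_mul_card]
    rfl
  have hcard (c : ConjClasses G) :
      Nat.card c.carrier = (Finset.univ.filter fun g ↦ ConjClasses.mk g = c).card := by
    rw [Nat.card_eq_fintype_card, ← Set.toFinset_card]
    congr 1
    ext g
    simp [ConjClasses.mem_carrier_iff_mk_eq]
  by_cases h : ∃ g, ConjClasses.mk g = c ∧ p g
  · rw [if_pos h]
    obtain ⟨g, rfl, hg⟩ := h
    rw [← hc g, hcard, mul_comm, ← smul_eq_mul, ← Finset.sum_const]
    refine Finset.sum_congr rfl fun k hk ↦ ?_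
    have hk' : ConjClasses.mk k = ConjClasses.mk g := by simpa using hk
    rw [if_pos (hp g k (ConjClasses.mk_eq_mk_iff_isConj.mp hk'.symm) hg)]
    have h1 := hc k
    rw [hk', ← hc g] at h1
    have : Nonempty (ConjClasses.mk g).carrier := ⟨g, ConjClasses.mem_carrier_mk⟩
    exact Nat.eq_of_mul_eq_mul_right Nat.card_pos h1
  · rw [if_neg h]
    refine Finset.sum_eq_zero fun k hk ↦ if_neg fun hpk ↦ h ⟨k, by simpa using hk, hpk⟩

theorem sum_sum_commute_eq {G : Type*} [Group G] [Fintype G] [DecidableRel (Commute (S := G))] :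
    ∑ g : G, ∑ h : G, (if Commute g h then (1 : ℤ) else 0) =
      Nat.card (ConjClasses G) * Nat.card G := by
  rw [← Nat.cast_mul, ← card_comm_eq_card_conjClasses_mul_card, Nat.card_eq_fintype_card,
    Fintype.card_subtype, Finset.card_filter, ← Finset.univ_product_univ, Finset.sum_product]
  push_cast
  rfl

open Subgroup in
/-- Orthogonality: a sign character summed over a centralizer vanishes unless it is trivial
there. -/
theorem sum_commute_sign {G : Type*} [Group G] [Fintype G] [DecidableRel (Commute (S := G))]
    (ε : G →* ℤˣ) (g : G) [Decidable (centralizer {g} ≤ ε.ker)] :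
    ∑ h : G, (if Commute g h then (ε h : ℤ) else 0) =
      if centralizer {g} ≤ ε.ker then (Nat.card (centralizer {g}) : ℤ) else 0 := by
  classical
  have key := sum_hom_units (R := ℤ) (((Units.coeHom ℤ).comp ε).comp (centralizer {g}).subtype)
  have h1 : ((((Units.coeHom ℤ).comp ε).comp (centralizer {g}).subtype) = 1) ↔
      centralizer {g} ≤ ε.ker := by
    simp [MonoidHom.ext_iff, SetLike.le_def, MonoidHom.mem_ker]
  simp only [h1] at key
  rw [Nat.card_eq_fintype_card]
  push_cast at key
  rw [← key, ← Finset.sum_filter]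
  refine Finset.sum_subtype _ (fun x ↦ ?_) _
  rw [mem_centralizer_singleton_iff, Finset.mem_filter, commute_iff_eq, eq_comm]
  simp

open Subgroup in
/-- Conjugacy classes of an index-two kernel: `k(G) + 3 s = 2 k(ker ε)`, where `s` counts the
classes of `G` whose elements have centralizer inside `ker ε`. -/
theorem card_conjClasses_add_three_mul {G : Type*} [Group G] [Fintype G] (ε : G →* ℤˣ)
    (hε : 2 * Nat.card ε.ker = Nat.card G) :
    Nat.card (ConjClasses G) +
      3 * Nat.card {c : ConjClasses G // ∃ g, ConjClasses.mk g = c ∧ centralizer {g} ≤ ε.ker} =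
      2 * Nat.card (ConjClasses ε.ker) := by
  classical
  have hconj (g h : G) (hgh : IsConj g h) (hg : centralizer {g} ≤ ε.ker) :
      centralizer {h} ≤ ε.ker := by
    obtain ⟨c, rfl⟩ := isConj_iff.mp hgh
    intro x hx
    have hx' : c⁻¹ * x * c ∈ centralizer {g} := by
      rw [mem_centralizer_singleton_iff] at hx ⊢
      have := congrArg (fun y ↦ c⁻¹ * y * c) hx
      simpa [mul_assoc] using this
    simpa [MonoidHom.mem_ker, mul_comm, ← mul_assoc] using hg hx'
  have hS := sum_card_centralizer_eq_card_mul_card_conjClasses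
    (fun g : G ↦ centralizer {g} ≤ ε.ker) hconj
  set s := Nat.card {c : ConjClasses G // ∃ g, ConjClasses.mk g = c ∧ centralizer {g} ≤ ε.ker}
  have hN := sum_sum_commute_eq (G := G)
  have hH := sum_sum_commute_eq (G := ε.ker)
  have hM : ∑ g : G, ∑ h : G, (if Commute g h then (ε h : ℤ) else 0) = Nat.card G * s := by
    simp_rw [sum_commute_sign]
    exact_mod_cast hS
  have hM' : ∑ g : G, ∑ h : G, (if Commute g h then (ε g : ℤ) else 0) = Nat.card G * s := by
    rw [Finset.sum_comm, ← hM]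
    simp_rw [Commute.symm_iff]
  have hP : ∑ g : G, ∑ h : G, (if Commute g h then (ε g * ε h : ℤ) else 0) = Nat.card G * s := by
    rw [← hM]
    refine Finset.sum_congr rfl fun g _ ↦ ?_
    have : ∀ h, (if Commute g h then (ε g * ε h : ℤ) else 0) =
        ε g * (if Commute g h then (ε h : ℤ) else 0) := by simp
    rw [Finset.sum_congr rfl fun h _ ↦ this h, ← Finset.mul_sum, sum_commute_sign]
    split_ifs with hg
    · have : ε g = 1 := hg (mem_centralizer_singleton_iff.mpr rfl)
      simp [this]
    · simp
  have hsub (f : G → ℤ) : ∑ h : ε.ker, f h = ∑ h : G, if ε h = 1 then f h else 0 := by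
    rw [← Finset.sum_filter]
    exact (Finset.sum_subtype _ (by simp [MonoidHom.mem_ker]) _).symm
  have hH' : 4 * ∑ g : ε.ker, ∑ h : ε.ker, (if Commute g h then (1 : ℤ) else 0) =
      ∑ g : G, ∑ h : G, ((if Commute g h then (1 : ℤ) else 0) +
        (if Commute g h then (ε h : ℤ) else 0) + (if Commute g h then (ε g : ℤ) else 0) +
        (if Commute g h then (ε g * ε h : ℤ) else 0)) := by
    have h1 (g h : ε.ker) : (if Commute g h then (1 : ℤ) else 0) =
        if Commute (g : G) (h : G) then 1 else 0 := by
      congr 1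
      simp [commute_iff_eq, Subtype.ext_iff]
    simp_rw [h1]
    rw [hsub fun g ↦ ∑ h : ε.ker, if Commute g (h : G) then (1 : ℤ) else 0, Finset.mul_sum]
    refine Finset.sum_congr rfl fun g _ ↦ ?_
    rw [hsub fun h ↦ if Commute g h then (1 : ℤ) else 0, ← Finset.sum_const_zero (ι := G)
      (s := Finset.univ), ← Finset.sum_ite_irrel, Finset.mul_sum]
    refine Finset.sum_congr rfl fun h _ ↦ ?_
    rcases Int.units_eq_one_or (ε g) with hg | hg <;>
      rcases Int.units_eq_one_or (ε h) with hh | hh <;> by_cases hc : Commute g h <;>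
      simp [hg, hh, hc]
  simp only [Finset.sum_add_distrib] at hH'
  rw [hN, hM, hM', hP, hH] at hH'
  have hpos : (0 : ℤ) < Nat.card G := by exact_mod_cast Nat.card_pos
  have hε' : (2 : ℤ) * Nat.card ε.ker = Nat.card G := by exact_mod_cast hε
  zify
  refine mul_right_cancel₀ hpos.ne' ?_
  linear_combination -hH' + 2 * (Nat.card (ConjClasses ε.ker) : ℤ) * hε'

/-- The number of elements of `A` that are at least `d`. -/
def countGE (A : Finset ℕ) (d : ℕ) : ℕ := (A.filter (d ≤ ·)).card

theorem countGE_anti (A : Finset ℕ) {d e : ℕ} (h : d ≤ e) : countGE A e ≤ countGE A d :=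
  Finset.card_le_card <| Finset.monotone_filter_right _ fun _ _ hx ↦ h.trans hx

theorem countGE_eq_succ_add (A : Finset ℕ) (d : ℕ) :
    countGE A d = countGE A (d + 1) + if d ∈ A then 1 else 0 := by
  unfold countGE
  split_ifs with h
  · rw [← Finset.card_insert_of_notMem (a := d) (by simp)]
    congr 1
    ext x
    simp only [Finset.mem_filter, Finset.mem_insert]
    grind
  · congr 1
    ext x
    simp only [Finset.mem_filter]
    grind

theorem countGE_le_add (A : Finset ℕ) (d k : ℕ) : countGE A d ≤ countGE A (d + k) + k := by
  induction k with
  | zero => simp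
  | succ k ih =>
    have := countGE_eq_succ_add A (d + k)
    rw [show d + (k + 1) = d + k + 1 from rfl]
    split_ifs at this <;> omega

theorem countGE_injective : Function.Injective countGE := by
  intro A B h
  ext d
  have hA := countGE_eq_succ_add A d
  have hB := countGE_eq_succ_add B d
  rw [h] at hA
  grind

theorem countGE_eq_zero {A : Finset ℕ} {d : ℕ} (h : ∀ a ∈ A, a < d) : countGE A d = 0 := by
  simpa [countGE, Finset.filter_eq_empty_iff] using h

theorem le_sup_of_lt_countGE {A : Finset ℕ} {m d : ℕ} (h : m < countGE A d) : d ≤ A.sup id := by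
  by_contra! hd
  rw [countGE_eq_zero fun a ha ↦ (Finset.le_sup (f := id) ha).trans_lt hd] at h
  omega

namespace YoungDiagram

theorem lt_of_lt_countGE_dist (A : Finset ℕ) {i j : ℕ} (h : min i j < countGE A (Nat.dist i j)) :
    i < 2 * (A.sup id + 1) ∧ j < 2 * (A.sup id + 1) := by
  have hd := le_sup_of_lt_countGE h
  have hc : countGE A (Nat.dist i j) ≤ A.sup id + 1 := by
    refine (Finset.card_le_card (t := Finset.range (A.sup id + 1)) fun a ha ↦ ?_).trans
      (Finset.card_range _).le
    have := Finset.le_sup (f := id) (Finset.mem_of_mem_filter a ha)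
    simpa [Nat.lt_succ_iff] using this
  unfold Nat.dist at *
  omega

/-- The self-conjugate Young diagram whose principal hooks have the sizes `2 * a + 1`, `a ∈ A`. -/
def ofHooks (A : Finset ℕ) : YoungDiagram where
  cells := (Finset.range (2 * (A.sup id + 1)) ×ˢ Finset.range (2 * (A.sup id + 1))).filter
    fun c ↦ min c.1 c.2 < countGE A (Nat.dist c.1 c.2)
  isLowerSet := by
    rintro ⟨i, j⟩ ⟨i', j'⟩ hle h
    obtain ⟨hi, hj⟩ := Prod.mk_le_mk.mp hle
    simp only [Finset.coe_filter, Finset.mem_product, Finset.mem_range, Set.mem_ofPred_eq] at h ⊢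
    refine ⟨by omega, ?_⟩
    replace h := h.2
    by_cases hd : Nat.dist i' j' ≤ Nat.dist i j
    · have := countGE_anti A hd
      omega
    · obtain ⟨k, hk⟩ := Nat.exists_eq_add_of_le (not_le.mp hd).le
      have := countGE_le_add A (Nat.dist i j) k
      rw [← hk] at this
      unfold Nat.dist at *
      omega

theorem mem_ofHooks {A : Finset ℕ} {i j : ℕ} :
    (i, j) ∈ ofHooks A ↔ min i j < countGE A (Nat.dist i j) := by
  rw [← mem_cells]
  simp only [ofHooks, Finset.mem_filter, Finset.mem_product, Finset.mem_range]
  exact ⟨And.right, fun h ↦ ⟨lt_of_lt_countGE_dist A h, h⟩⟩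

theorem transpose_ofHooks (A : Finset ℕ) : (ofHooks A).transpose = ofHooks A := by
  refine SetLike.ext fun ⟨i, j⟩ ↦ ?_
  rw [mem_transpose, Prod.swap_prod_mk, mem_ofHooks, mem_ofHooks, min_comm, Nat.dist_comm]

theorem ofHooks_injective : Function.Injective ofHooks := by
  intro A B h
  refine countGE_injective (funext fun d ↦ eq_of_forall_lt_iff fun m ↦ ?_)
  have := SetLike.ext_iff.mp h (m, m + d)
  simpa [mem_ofHooks, Nat.dist] using this

/-- The number of cells `(i, i + d)` of a Young diagram. -/
def diagLen (μ : YoungDiagram) (d : ℕ) : ℕ :=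
  ((Finset.range (μ.rowLen 0 + 1)).filter fun i ↦ (i, i + d) ∈ μ).card

theorem lt_diagLen_iff (μ : YoungDiagram) (i d : ℕ) : i < μ.diagLen d ↔ (i, i + d) ∈ μ := by
  have hex : ∃ i, (i, i + d) ∉ μ := by
    obtain ⟨j, hj⟩ := μ.exists_notMem_row 0
    exact ⟨j, fun h ↦ hj (μ.up_left_mem (Nat.zero_le _) (Nat.le_add_right _ _) h)⟩
  classical
  have hfind (i : ℕ) : (i, i + d) ∈ μ ↔ i < Nat.find hex := by
    rw [Nat.lt_find_iff]
    exact ⟨fun h m hm ↦ not_not.mpr (μ.up_left_mem hm (by omega) h), fun h ↦ not_not.mp (h i le_rfl)⟩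
  suffices μ.diagLen d = Nat.find hex by rw [this, hfind]
  rw [← Finset.card_range (Nat.find hex), diagLen]
  congr 1
  ext i
  rw [Finset.mem_filter, Finset.mem_range, Finset.mem_range, hfind]
  refine ⟨And.right, fun h ↦ ⟨?_, h⟩⟩
  have := μ.up_left_mem (Nat.zero_le i) (Nat.le_add_right i d) ((hfind i).mpr h)
  have := mem_iff_lt_rowLen.mp this
  omega

theorem exists_ofHooks_eq {μ : YoungDiagram} (hμ : μ.transpose = μ) : ∃ A, ofHooks A = μ := by
  have hanti (d : ℕ) : μ.diagLen (d + 1) ≤ μ.diagLen d := by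
    refine le_of_forall_lt fun i hi ↦ ?_
    rw [lt_diagLen_iff] at hi ⊢
    exact μ.up_left_mem le_rfl (by omega) hi
  have hstep (d : ℕ) : μ.diagLen d ≤ μ.diagLen (d + 1) + 1 := by
    by_contra! h
    have h1 := (lt_diagLen_iff _ _ _).mp h
    have := (lt_diagLen_iff μ (μ.diagLen (d + 1)) (d + 1)).mpr
      (μ.up_left_mem (Nat.le_succ _) (by omega) h1)
    omega
  have hzero (d : ℕ) (hd : μ.rowLen 0 ≤ d) : μ.diagLen d = 0 := by
    by_contra h
    have := mem_iff_lt_rowLen.mp ((lt_diagLen_iff μ 0 d).mp (Nat.pos_of_ne_zero h))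
    omega
  let A := (Finset.range (μ.rowLen 0)).filter fun d ↦ μ.diagLen (d + 1) < μ.diagLen d
  have hA (k : ℕ) : ∀ d, μ.rowLen 0 ≤ d + k → countGE A d = μ.diagLen d := by
    induction k with
    | zero =>
      intro d hd
      rw [hzero d hd]
      refine countGE_eq_zero fun a ha ↦ ?_
      have := Finset.mem_range.mp (Finset.mem_of_mem_filter a ha)
      omega
    | succ k ih =>
      intro d hd
      have hmem : d ∈ A ↔ μ.diagLen (d + 1) < μ.diagLen d := by
        simp only [A, Finset.mem_filter, Finset.mem_range, and_iff_right_iff_imp]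
        intro h
        by_contra! hd
        rw [hzero d hd] at h
        omega
      rw [countGE_eq_succ_add, ih (d + 1) (by omega)]
      have := hanti d
      have := hstep d
      split_ifs with h <;> rw [hmem] at h <;> omega
  have hA' (d : ℕ) : countGE A d = μ.diagLen d := hA (μ.rowLen 0) d (Nat.le_add_left _ _)
  refine ⟨A, SetLike.ext fun ⟨i, j⟩ ↦ ?_⟩
  rw [mem_ofHooks, hA', lt_diagLen_iff]
  rcases le_total i j with h | h
  · rw [min_eq_left h, Nat.dist_eq_sub_of_le h, Nat.add_sub_cancel' h]
  · rw [min_eq_right h, Nat.dist_comm, Nat.dist_eq_sub_of_le h, Nat.add_sub_cancel' h]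
    nth_rw 1 [← hμ]
    rw [mem_transpose, Prod.swap_prod_mk]

theorem card_filter_ofHooks (A : Finset ℕ) (δ : ℤ) :
    ((ofHooks A).cells.filter fun c ↦ (c.2 : ℤ) - c.1 = δ).card = countGE A δ.natAbs := by
  rw [← Finset.card_range (countGE A δ.natAbs)]
  refine Finset.card_bij' (fun c _ ↦ min c.1 c.2) (fun m _ ↦ (m + (-δ).toNat, m + δ.toNat)) ?_ ?_ ?_ ?_
  · rintro ⟨i, j⟩ h
    simp only [Finset.mem_filter, mem_cells, mem_ofHooks, Finset.mem_range] at h ⊢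
    obtain ⟨h, rfl⟩ := h
    convert h using 2
    unfold Nat.dist
    omega
  · intro m h
    simp only [Finset.mem_filter, mem_cells, mem_ofHooks, Finset.mem_range] at h ⊢
    refine ⟨?_, by omega⟩
    convert h using 1
    · omega
    · congr 1
      unfold Nat.dist
      omega
  · rintro ⟨i, j⟩ h
    simp only [Finset.mem_filter] at h
    ext <;> simp only <;> omega
  · intro m h
    simp only
    omega

theorem card_ofHooks (A : Finset ℕ) : (ofHooks A).card = ∑ a ∈ A, (2 * a + 1) := by
  set N : ℤ := ((A.sup id : ℕ) : ℤ)
  have hmaps : ∀ c ∈ (ofHooks A).cells, (c.2 : ℤ) - c.1 ∈ Finset.Icc (-N) N := by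
    rintro ⟨i, j⟩ h
    rw [mem_cells, mem_ofHooks] at h
    have hd := le_sup_of_lt_countGE h
    unfold Nat.dist at hd
    simp only [Finset.mem_Icc, N]
    omega
  rw [YoungDiagram.card, Finset.card_eq_sum_card_fiberwise hmaps]
  simp_rw [card_filter_ofHooks, countGE, Finset.card_filter]
  rw [Finset.sum_comm]
  refine Finset.sum_congr rfl fun a ha ↦ ?_
  have ha' : a ≤ A.sup id := Finset.le_sup (f := id) ha
  rw [← Finset.card_filter]
  have : (Finset.Icc (-N) N).filter (fun δ ↦ δ.natAbs ≤ a) = Finset.Icc (-a : ℤ) a := by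
    ext δ
    simp only [Finset.mem_filter, Finset.mem_Icc, N]
    omega
  rw [this, Int.card_Icc]
  omega

/-- Self-conjugate Young diagrams with `n` cells correspond to sets of naturals `A` with
`∑ a ∈ A, (2 * a + 1) = n`. -/
noncomputable def hooksEquiv (n : ℕ) : {A : Finset ℕ // ∑ a ∈ A, (2 * a + 1) = n} ≃
    {μ : YoungDiagram // μ.card = n ∧ μ.transpose = μ} :=
  Equiv.ofBijective
    (fun A ↦ ⟨ofHooks A, (card_ofHooks _).trans A.2, transpose_ofHooks _⟩)
    ⟨fun A B h ↦ Subtype.ext (ofHooks_injective (congrArg Subtype.val h)), by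
      rintro ⟨μ, hc, ht⟩
      obtain ⟨A, rfl⟩ := exists_ofHooks_eq ht
      exact ⟨⟨A, (card_ofHooks A).symm.trans hc⟩, rfl⟩⟩

end YoungDiagram

/-- Sets of naturals as partitions into distinct odd parts. -/
def oddDistinctsEquiv (n : ℕ) : {A : Finset ℕ // ∑ a ∈ A, (2 * a + 1) = n} ≃
    {p : n.Partition // p.parts.Nodup ∧ ∀ i ∈ p.parts, Odd i} where
  toFun A := ⟨⟨A.1.val.map (2 * · + 1), fun {i} hi ↦ by
      obtain ⟨a, -, rfl⟩ := Multiset.mem_map.mp hi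
      exact Nat.succ_pos _, A.2⟩,
    A.1.nodup.map fun a b h ↦ by simpa using h, by simp⟩
  invFun p := ⟨p.1.parts.toFinset.image (· / 2), by
    have hodd := p.2.2
    rw [Finset.sum_image]
    · conv_rhs => rw [← p.1.parts_sum, ← p.2.1.dedup]
      rw [← Multiset.toFinset_val, Finset.sum_val]
      refine Finset.sum_congr rfl fun i hi ↦ ?_
      have := hodd i (by simpa using hi)
      exact Nat.two_mul_div_two_add_one_of_odd this
    · intro a ha b hb h
      have h1 := hodd a (by simpa using ha)
      have h2 := hodd b (by simpa using hb)
      simp only at h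
      grind⟩
  left_inv A := by
    ext x
    simp
    grind
  right_inv p := by
    obtain ⟨p, hp, hodd⟩ := p
    refine Subtype.ext (Nat.Partition.ext ?_)
    refine (Multiset.Nodup.ext ?_ hp).mpr fun i ↦ ?_
    · exact (Finset.nodup _).map fun a b h ↦ by simpa using h
    · simp
      grind

theorem Equiv.Perm.exists_partition_eq {α : Type*} [Fintype α] [DecidableEq α]
    (p : (Fintype.card α).Partition) : ∃ σ : Equiv.Perm α, σ.partition = p := by
  obtain ⟨σ, hσ⟩ := (Equiv.Perm.exists_with_cycleType_iff α (m := p.parts.filter (2 ≤ ·))).mpr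
    ⟨by
      conv_rhs => rw [← p.parts_sum, ← Multiset.filter_add_not (2 ≤ ·) p.parts, Multiset.sum_add]
      exact Nat.le_add_right _ _, fun a ha ↦ (Multiset.mem_filter.mp ha).2⟩
  refine ⟨σ, Nat.Partition.ext ?_⟩
  have h1 : p.parts.filter (fun i ↦ ¬ 2 ≤ i) =
      Multiset.replicate (p.parts.filter (fun i ↦ ¬ 2 ≤ i)).card 1 := by
    refine Multiset.eq_replicate_card.mpr fun i hi ↦ ?_
    have := p.parts_pos (Multiset.mem_of_mem_filter hi)
    have := (Multiset.mem_filter.mp hi).2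
    omega
  have h2 := p.parts_sum
  rw [← Multiset.filter_add_not (2 ≤ ·) p.parts, Multiset.sum_add, h1, Multiset.sum_replicate,
    ← hσ, Equiv.Perm.sum_cycleType, smul_eq_mul, mul_one] at h2
  rw [Equiv.Perm.parts_partition, Nat.sub_eq_of_eq_add' h2.symm, ← h1, hσ,
    Multiset.filter_add_not]

theorem Equiv.Perm.centralizer_le_alternatingGroup_iff_partition {α : Type*} [Fintype α]
    [DecidableEq α] (σ : Equiv.Perm α) :
    Subgroup.centralizer {σ} ≤ alternatingGroup α ↔
      σ.partition.parts.Nodup ∧ ∀ i ∈ σ.partition.parts, Odd i := by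
  rw [Equiv.Perm.centralizer_le_alternating_iff, Equiv.Perm.parts_partition, Multiset.nodup_add,
    Multiset.nodup_iff_count_le_one, Equiv.Perm.sum_cycleType]
  have h1 : (Multiset.replicate (Fintype.card α - σ.support.card) 1).Nodup ↔
      Fintype.card α - σ.support.card ≤ 1 := by
    rw [Multiset.nodup_iff_count_le_one]
    refine ⟨fun h ↦ by simpa using h 1, fun h a ↦ ?_⟩
    rw [Multiset.count_replicate]
    split_ifs <;> omega
  have h2 : _root_.Disjoint σ.cycleType (Multiset.replicate (Fintype.card α - σ.support.card) 1) := by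
    rw [Multiset.disjoint_left]
    intro a ha ha'
    have := Equiv.Perm.one_lt_of_mem_cycleType ha
    have := Multiset.eq_of_mem_replicate ha'
    omega
  rw [h1]
  simp only [h2, and_true, Multiset.mem_add]
  constructor
  · rintro ⟨ho, hc, hn⟩
    refine ⟨⟨hn, by omega⟩, fun i hi ↦ hi.elim (ho i) fun hi ↦ ?_⟩
    rw [Multiset.eq_of_mem_replicate hi]
    exact odd_one
  · rintro ⟨⟨hn, hc⟩, ho⟩
    exact ⟨fun c hc ↦ ho c (Or.inl hc), by omega, hn⟩

/-- Conjugacy classes of permutations correspond to partitions. -/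
noncomputable def Equiv.Perm.conjClassesEquivPartition (α : Type*) [Fintype α] [DecidableEq α] :
    ConjClasses (Equiv.Perm α) ≃ (Fintype.card α).Partition :=
  Equiv.ofBijective
    (Quotient.lift Equiv.Perm.partition fun _ _ h ↦ Equiv.Perm.partition_eq_of_isConj.mp h)
    ⟨by
      rintro ⟨σ⟩ ⟨τ⟩ h
      exact Quotient.sound (Equiv.Perm.partition_eq_of_isConj.mpr h), fun p ↦
      let ⟨σ, hσ⟩ := Equiv.Perm.exists_partition_eq p
      ⟨ConjClasses.mk σ, hσ⟩⟩

theorem card_conjClasses_centralizer_le_alternatingGroup (α : Type*) [Fintype α]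
    [DecidableEq α] :
    Nat.card {c : ConjClasses (Equiv.Perm α) // ∃ g, ConjClasses.mk g = c ∧
      Subgroup.centralizer {g} ≤ alternatingGroup α} =
      selfConjugatePartitions (Fintype.card α) := by
  rw [selfConjugatePartitions, ← Nat.card_congr (YoungDiagram.hooksEquiv _),
    Nat.card_congr (oddDistinctsEquiv _)]
  refine Nat.card_congr ((Equiv.Perm.conjClassesEquivPartition α).subtypeEquiv ?_)
  rintro ⟨σ⟩
  change _ ↔ σ.partition.parts.Nodup ∧ ∀ i ∈ σ.partition.parts, Odd i
  rw [← Equiv.Perm.centralizer_le_alternatingGroup_iff_partition]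
  refine ⟨?_, fun h ↦ ⟨σ, rfl, h⟩⟩
  rintro ⟨g, hg, h⟩
  rw [Equiv.Perm.centralizer_le_alternatingGroup_iff_partition] at h ⊢
  rwa [← Equiv.Perm.partition_eq_of_isConj.mp (ConjClasses.mk_eq_mk_iff_isConj.mp hg)]

theorem stmt14 (n : ℕ) (hn : 5 ≤ n) :
    (Nat.card (ConjClasses (Equiv.Perm (Fin n))) : ℤ) =
      2 * Nat.card (ConjClasses (alternatingGroup (Fin n))) -
        3 * selfConjugatePartitions n := by
  have : Nontrivial (Fin n) := Fin.nontrivial_iff_two_le.mpr (by omega)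
  have h1 := card_conjClasses_add_three_mul (Equiv.Perm.sign (α := Fin n))
    two_mul_nat_card_alternatingGroup
  have h2 := card_conjClasses_centralizer_le_alternatingGroup (Fin n)
  rw [Fintype.card_fin] at h2
  unfold alternatingGroup at *
  rw [h2] at h1
  omega
end
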